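/- Assume condition (G) for some γ ∈ ℕ, d > 0 and L > 0, and let 0 ≤ K < L with [K]+1 ≤ γ. For φ ∈ L¹_K set v(x,t) := (e^{tℒ}φ)(x) − Σ_{|α| ≤ K} M_α(φ,0) g_α(x,t). Then for any j ∈ {0,…,γ}, q ∈ [1,∞] and ℓ ∈ [0,K] there exists a constant C, independent of φ ∈ L¹_K, such that t^{(N/d)(1−1/q)+j/d} ‖∇^j v(·,t)‖_q + t^{j/d}(1+t)^{−ℓ/d} |||∇^j v(·,t)|||_ℓ ≤ C (1+t)^{−K/d} |||φ|||_K for all t > 0. -/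

import Mathlib

open MeasureTheory Filter Asymptotics Topology
open scoped ENNReal BigOperators

noncomputable section

/-- Partial derivative in the `i`-th coordinate direction. -/
def pderivE (N : ℕ) (i : Fin N) (f : EuclideanSpace ℝ (Fin N) → ℝ) :
    EuclideanSpace ℝ (Fin N) → ℝ :=
  fun x => fderiv ℝ f x (EuclideanSpace.single i 1)

/-- Multi-index partial derivative `∂_x^α`. -/
def mderivE (N : ℕ) (α : Fin N → ℕ) (f : EuclideanSpace ℝ (Fin N) → ℝ) :
    EuclideanSpace ℝ (Fin N) → ℝ :=
  (List.ofFn fun i : Fin N => (pderivE N i)^[α i]).foldr (fun T h => T h) f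

/-- `x ^ α` for a multi-index `α`. -/
def mpowE (N : ℕ) (α : Fin N → ℕ) (x : EuclideanSpace ℝ (Fin N)) : ℝ :=
  ∏ i, x i ^ α i

/-- `α !` for a multi-index `α`. -/
def mfactE (N : ℕ) (α : Fin N → ℕ) : ℕ := ∏ i, Nat.factorial (α i)

/-- `g_α(x,t) := ((-1)^{|α|}/α!) ∂_x^α G(x, t+1)`. -/
def gA (N : ℕ) (G : EuclideanSpace ℝ (Fin N) → ℝ → ℝ) (α : Fin N → ℕ)
    (x : EuclideanSpace ℝ (Fin N)) (t : ℝ) : ℝ :=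
  ((-1 : ℝ) ^ (∑ i, α i) / (mfactE N α : ℝ)) * mderivE N α (fun y => G y (t + 1)) x

/-- Condition (G) for the kernel `G` with parameters `γ`, `d`, `L`. -/
structure CondG (N : ℕ) (G : EuclideanSpace ℝ (Fin N) → ℝ → ℝ) (γ : ℕ) (d L : ℝ) : Prop where
  smooth : ContDiffOn ℝ γ (fun p : EuclideanSpace ℝ (Fin N) × ℝ => G p.1 p.2) {p | 0 < p.2}
  scaling : ∀ x : EuclideanSpace ℝ (Fin N), ∀ t : ℝ, 0 < t →
      G x t = t ^ (-(N : ℝ) / d) * G ((t ^ (-(1 : ℝ) / d)) • x) 1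
  decay : ∀ j : ℕ, j ≤ γ → ∃ C : ℝ, ∀ x : EuclideanSpace ℝ (Fin N),
      (1 + ‖x‖) ^ ((N : ℝ) + L + j) * ‖iteratedFDeriv ℝ j (fun y => G y 1) x‖ ≤ C
  semigroup : ∀ x : EuclideanSpace ℝ (Fin N), ∀ t s : ℝ, 0 < s → s < t →
      G x t = ∫ y, G (x - y) (t - s) * G y s

/-- `(e^{tℒ}φ)(x) = ∫ G(x-y,t) φ(y) dy`. -/
def sgOp (N : ℕ) (G : EuclideanSpace ℝ (Fin N) → ℝ → ℝ) (t : ℝ)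
    (φ : EuclideanSpace ℝ (Fin N) → ℝ) : EuclideanSpace ℝ (Fin N) → ℝ :=
  fun x => ∫ y, G (x - y) t * φ y

/-- `∫ x^α f(x) dx`. -/
def momE (N : ℕ) (α : Fin N → ℕ) (f : EuclideanSpace ℝ (Fin N) → ℝ) : ℝ :=
  ∫ x, mpowE N α x * f x

/-- Auxiliary fuelled recursion computing the coefficients `M_α(f,t)`. -/
def McoefAux (N : ℕ) (G : EuclideanSpace ℝ (Fin N) → ℝ → ℝ)
    (f : EuclideanSpace ℝ (Fin N) → ℝ) (t : ℝ) : ℕ → (Fin N → ℕ) → ℝ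
  | 0, α => momE N α f
  | n + 1, α => momE N α f -
      ∑ β ∈ (Finset.Iic α).erase α,
        McoefAux N G f t n β * ∫ x, mpowE N α x * gA N G β x t

/-- `M_α(f,t)`, defined inductively on `|α|`:
`M_α(f,t) = ∫ x^α f dx - ∑_{β ≤ α, β ≠ α} M_β(f,t) ∫ x^α g_β(x,t) dx`. -/
def Mcoef (N : ℕ) (G : EuclideanSpace ℝ (Fin N) → ℝ → ℝ)
    (f : EuclideanSpace ℝ (Fin N) → ℝ) (t : ℝ) (α : Fin N → ℕ) : ℝ :=
  McoefAux N G f t (∑ i, α i) α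

/-- The finite set of multi-indices `α` with `|α| ≤ m`. -/
def multiIdx (N m : ℕ) : Finset (Fin N → ℕ) :=
  (Finset.Iic fun _ => m).filter fun α => ∑ i, α i ≤ m

/-- `P_K(t)f := f - ∑_{|α| ≤ K} M_α(f,t) g_α(·,t)`. -/
def PKop (N : ℕ) (G : EuclideanSpace ℝ (Fin N) → ℝ → ℝ) (K : ℝ) (t : ℝ)
    (f : EuclideanSpace ℝ (Fin N) → ℝ) : EuclideanSpace ℝ (Fin N) → ℝ :=
  fun x => f x - ∑ α ∈ multiIdx N ⌊K⌋₊, Mcoef N G f t α * gA N G α x t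

/-- The weighted `L¹` norm `|||φ|||_k = ∫ (1+|x|^k) ‖φ(x)‖ dx`, valued in `ℝ≥0∞`. -/
def wnorm (N : ℕ) {E' : Type*} [NormedAddCommGroup E'] (k : ℝ)
    (φ : EuclideanSpace ℝ (Fin N) → E') : ℝ≥0∞ :=
  ∫⁻ x, ENNReal.ofReal ((1 + ‖x‖ ^ k) * ‖φ x‖)

/-- Membership in `L¹_k = L¹(ℝ^N, (1+|x|^k)dx)`. -/
def MemL1k (N : ℕ) (k : ℝ) (φ : EuclideanSpace ℝ (Fin N) → ℝ) : Prop :=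
  AEStronglyMeasurable φ (volume : Measure (EuclideanSpace ℝ (Fin N))) ∧ wnorm N k φ < ⊤

/-- `E_{K,q}[f](t) = (1+t)^{K/d}[t^{(N/d)(1-1/q)} ‖f(t)‖_q + ‖f(t)‖_1] + |||f(t)|||_K`. -/
def Efun (N : ℕ) (d K : ℝ) (q : ℝ≥0∞) (f : EuclideanSpace ℝ (Fin N) → ℝ → ℝ) (t : ℝ) :
    ℝ≥0∞ :=
  ENNReal.ofReal ((1 + t) ^ (K / d)) *
      (ENNReal.ofReal (t ^ (((N : ℝ) / d) * (1 - q.toReal⁻¹))) *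
          eLpNorm (fun x => f x t) q volume +
        eLpNorm (fun x => f x t) 1 volume) +
    wnorm N K (fun x => f x t)

/-- `t^{(N/d)(1-1/q)} ‖w(t)‖_q + t^{-ℓ/d} |||w(t)|||_ℓ`. -/
def DistQ (N : ℕ) (d : ℝ) (q : ℝ≥0∞) (ℓ : ℝ) (w : EuclideanSpace ℝ (Fin N) → ℝ → ℝ)
    (t : ℝ) : ℝ≥0∞ :=
  ENNReal.ofReal (t ^ (((N : ℝ) / d) * (1 - q.toReal⁻¹))) * eLpNorm (fun x => w x t) q volume +
    ENNReal.ofReal (t ^ (-ℓ / d)) * wnorm N ℓ (fun x => w x t)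

end

namespace SelfSimilar

section General

theorem rpow_mul_one_add_rpow_neg_le {r ℓ a : ℝ} (hr : 0 ≤ r) (hℓ : 0 ≤ ℓ) :
    r ^ ℓ * (1 + r) ^ (-a) ≤ (1 + r) ^ (-(a - ℓ)) := by
  have h : (1 + r) ^ (-(a - ℓ)) = (1 + r) ^ ℓ * (1 + r) ^ (-a) := by
    rw [← Real.rpow_add (by linarith)]; ring_nf
  rw [h]
  gcongr
  linarith

theorem add_rpow_le_two_rpow_mul {r s ℓ : ℝ} (hr : 0 ≤ r) (hs : 0 ≤ s) (hℓ : 0 ≤ ℓ) :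
    (r + s) ^ ℓ ≤ 2 ^ ℓ * (r ^ ℓ + s ^ ℓ) := by
  have hm : (r + s) ^ ℓ ≤ (2 * max r s) ^ ℓ := by
    gcongr
    linarith [le_max_left r s, le_max_right r s]
  rw [Real.mul_rpow (by norm_num) (le_max_of_le_left hr)] at hm
  refine hm.trans ?_
  gcongr
  rcases max_choice r s with h | h <;> rw [h] <;>
    linarith [Real.rpow_nonneg hr ℓ, Real.rpow_nonneg hs ℓ]

variable {E : Type*} {F : Type*} [NormedAddCommGroup F]

theorem one_add_norm_rpow_neg_le_one [NormedAddCommGroup E] {a : ℝ} (ha : 0 ≤ a) (x : E) : (1 + ‖x‖) ^ (-a) ≤ 1 :=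
  Real.rpow_le_one_of_one_le_of_nonpos (by linarith [norm_nonneg x]) (by linarith)

section

variable [MeasureSpace E]

/-- Interpolation between `L¹` and a uniform bound. -/
theorem eLpNorm_le_interpolate {f : E → F} {A B : ℝ≥0∞} (hBt : B ≠ ⊤) (hB : ∀ x, ‖f x‖ₑ ≤ B)
    (hA : ∫⁻ x, ‖f x‖ₑ ≤ A) {q : ℝ≥0∞} (hq : 1 ≤ q) :
    eLpNorm f q ≤ A ^ q.toReal⁻¹ * B ^ (1 - q.toReal⁻¹) := by
  rcases eq_or_ne q ⊤ with rfl | hq'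
  · simpa using eLpNormEssSup_le_of_ae_enorm_bound (Eventually.of_forall hB)
  have hq1 : 1 ≤ q.toReal := by
    simpa using (ENNReal.toReal_le_toReal (by simp) hq').2 hq
  have hq0 : 0 < q.toReal := by linarith
  have hp : ∀ x, ‖f x‖ₑ ^ q.toReal ≤ B ^ (q.toReal - 1) * ‖f x‖ₑ := fun x => by
    have h : ‖f x‖ₑ ^ q.toReal = ‖f x‖ₑ ^ (q.toReal - 1) * ‖f x‖ₑ := by
      conv_rhs => rw [← ENNReal.rpow_one (‖f x‖ₑ)]
      rw [← ENNReal.rpow_mul, one_mul, ← ENNReal.rpow_add_of_nonneg _ _ (by linarith) zero_le_one]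
      congr 1
      ring
    rw [h]
    exact mul_le_mul_left (ENNReal.rpow_le_rpow (hB x) (by linarith)) _
  rw [eLpNorm_eq_lintegral_rpow_enorm_toReal (by positivity) hq', one_div]
  calc (∫⁻ x, ‖f x‖ₑ ^ q.toReal) ^ q.toReal⁻¹
      ≤ (B ^ (q.toReal - 1) * A) ^ q.toReal⁻¹ := by
        gcongr
        calc _ ≤ ∫⁻ x, B ^ (q.toReal - 1) * ‖f x‖ₑ := lintegral_mono hp
          _ ≤ _ := by
            rw [lintegral_const_mul' _ _ (ENNReal.rpow_ne_top_of_nonneg (by linarith) hBt)]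
            gcongr
    _ = _ := by
        rw [ENNReal.mul_rpow_of_nonneg _ _ (by positivity), ← ENNReal.rpow_mul, mul_comm]
        congr 2
        field_simp

variable [NormedAddCommGroup E] [NormedSpace ℝ F]

/-- The convolution `∫ u(y) f(x - y) dy`. -/
noncomputable def conv (f : E → F) (u : E → ℝ) (x : E) : F := ∫ y, u y • f (x - y)

theorem enorm_conv_le (f : E → F) (u : E → ℝ) (x : E) :
    ‖conv f u x‖ₑ ≤ ∫⁻ y, ‖u y‖ₑ * ‖f (x - y)‖ₑ :=
  (enorm_integral_le_lintegral_enorm _).trans (lintegral_mono fun y => by rw [enorm_smul])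

end

variable [NormedAddCommGroup E] [NormedSpace ℝ E] [NormedSpace ℝ F]

/-- The function `f` is of class `C^n` and its derivatives of order at most `n` are
`O((1 + ‖x‖)^{-a})`. -/
structure HasDecay (n : ℕ) (a : ℝ) (f : E → F) : Prop where
  contDiff : ContDiff ℝ n f
  bound : ∀ k ≤ n, ∃ C, 0 ≤ C ∧ ∀ x, ‖iteratedFDeriv ℝ k f x‖ ≤ C * (1 + ‖x‖) ^ (-a)

theorem HasDecay.mono {n m : ℕ} {a : ℝ} {f : E → F} (hf : HasDecay n a f) (h : m ≤ n) :
    HasDecay m a f :=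
  ⟨hf.contDiff.of_le (by exact_mod_cast h), fun k hk => hf.bound k (hk.trans h)⟩

theorem HasDecay.exists_norm_le {n : ℕ} {a : ℝ} {f : E → F} (hf : HasDecay n a f) (ha : 0 ≤ a)
    {k : ℕ} (hk : k ≤ n) : ∃ C, 0 ≤ C ∧ ∀ x, ‖iteratedFDeriv ℝ k f x‖ ≤ C := by
  obtain ⟨C, hC, h⟩ := hf.bound k hk
  exact ⟨C, hC, fun x => (h x).trans
    (mul_le_of_le_one_right hC (one_add_norm_rpow_neg_le_one ha x))⟩

theorem HasDecay.exists_norm_apply_le {n : ℕ} {a : ℝ} {f : E → F} (hf : HasDecay n a f) :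
    ∃ C, 0 ≤ C ∧ ∀ x, ‖f x‖ ≤ C * (1 + ‖x‖) ^ (-a) := by
  simpa using hf.bound 0 (Nat.zero_le _)

variable [MeasureSpace E] [BorelSpace E] [FiniteDimensional ℝ E]

theorem integrable_smul_comp_sub {f : E → F} (hf : Continuous f) {C : ℝ} (hC : ∀ x, ‖f x‖ ≤ C)
    {u : E → ℝ} (hu : Integrable u) (x : E) : Integrable fun y => u y • f (x - y) := by
  refine (hu.norm.mul_const C).mono'
    (hu.1.smul (hf.comp (continuous_sub_left x)).aestronglyMeasurable)
    (Eventually.of_forall fun y => ?_)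
  rw [norm_smul]
  gcongr
  exact hC _

theorem hasFDerivAt_conv [CompleteSpace F] {f : E → F} (hf : ContDiff ℝ 1 f) {C C' : ℝ}
    (hC : ∀ x, ‖f x‖ ≤ C)
    (hC' : ∀ x, ‖fderiv ℝ f x‖ ≤ C') {u : E → ℝ} (hu : Integrable u) (x : E) :
    HasFDerivAt (conv f u) (conv (fderiv ℝ f) u x) x := by
  refine hasFDerivAt_integral_of_dominated_of_fderiv_le (s := Set.univ)
    (F' := fun x y => u y • fderiv ℝ f (x - y)) (bound := fun y => ‖u y‖ * C') univ_mem
    (Eventually.of_forall fun x => (integrable_smul_comp_sub hf.continuous hC hu x).1)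
    (integrable_smul_comp_sub hf.continuous hC hu x)
    (integrable_smul_comp_sub (hf.continuous_fderiv (by simp)) hC' hu x).1
    (Eventually.of_forall fun y z _ => ?_) (hu.norm.mul_const C')
    (Eventually.of_forall fun y z _ => ?_)
  · rw [norm_smul]
    gcongr
    exact hC' _
  · have := ((hf.differentiable (by simp)) (z - y)).hasFDerivAt.comp z
      ((hasFDerivAt_id z).sub_const y)
    simpa [Function.comp_def] using this.fun_const_smul (u y)

theorem HasDecay.iteratedFDeriv_conv [CompleteSpace F] {n : ℕ} {a : ℝ} {f : E → F}
    (hf : HasDecay n a f) (ha : 0 ≤ a) {u : E → ℝ} (hu : Integrable u) {j : ℕ} (hj : j ≤ n) :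
    iteratedFDeriv ℝ j (conv f u) = conv (iteratedFDeriv ℝ j f) u := by
  induction j with
  | zero =>
    ext x m
    obtain ⟨C, _, hC⟩ := hf.exists_norm_le ha (Nat.zero_le n)
    rw [iteratedFDeriv_zero_apply, conv, conv, ContinuousMultilinearMap.integral_apply]
    · simp
    · exact integrable_smul_comp_sub (hf.contDiff.continuous_iteratedFDeriv (by simp)) hC hu x
  | succ j ih =>
    obtain ⟨C, _, hC⟩ := hf.exists_norm_le ha (Nat.le_of_succ_le hj)
    obtain ⟨C', _, hC'⟩ := hf.exists_norm_le ha hj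
    have h1 : ContDiff ℝ 1 (iteratedFDeriv ℝ j f) :=
      hf.contDiff.iteratedFDeriv_right (by exact_mod_cast (by omega : 1 + j ≤ n))
    have hC'' : ∀ x, ‖fderiv ℝ (iteratedFDeriv ℝ j f) x‖ ≤ C' := fun x => by
      rw [norm_fderiv_iteratedFDeriv]
      exact hC' x
    ext x m
    have hi := integrable_smul_comp_sub (h1.continuous_fderiv (by simp)) hC'' hu x
    rw [iteratedFDeriv_succ_apply_left, ih (Nat.le_of_succ_le hj),
      (hasFDerivAt_conv h1 hC hC'' hu x).fderiv, conv, conv,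
      ContinuousMultilinearMap.integral_apply (integrable_smul_comp_sub
        (hf.contDiff.continuous_iteratedFDeriv (by exact_mod_cast hj)) hC' hu x),
      ContinuousLinearMap.integral_apply hi,
      ContinuousMultilinearMap.integral_apply (hi.apply_continuousLinearMap (m 0))]
    simp [iteratedFDeriv_succ_apply_left]

variable [(volume : Measure E).IsAddHaarMeasure]

theorem lintegral_rpow_mul_one_add_norm_lt_top {a ℓ : ℝ} (hℓ : 0 ≤ ℓ)
    (h : Module.finrank ℝ E + ℓ < a) :
    ∫⁻ x : E, ENNReal.ofReal (‖x‖ ^ ℓ * (1 + ‖x‖) ^ (-a)) < ⊤ := by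
  refine lt_of_le_of_lt (lintegral_mono fun x => ENNReal.ofReal_le_ofReal
    (rpow_mul_one_add_rpow_neg_le (norm_nonneg x) hℓ)) ?_
  exact finite_integral_one_add_norm (by linarith)

/-- The weighted `L¹` norms of the derivatives of a decaying function are finite. -/
theorem HasDecay.lintegral_rpow_lt_top {n : ℕ} {a ℓ : ℝ} {f : E → F} (hf : HasDecay n a f)
    (hℓ : 0 ≤ ℓ) (h : Module.finrank ℝ E + ℓ < a) {k : ℕ} (hk : k ≤ n) :
    ∫⁻ x : E, ENNReal.ofReal (‖x‖ ^ ℓ) * ‖iteratedFDeriv ℝ k f x‖ₑ < ⊤ := by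
  obtain ⟨C, hC, hb⟩ := hf.bound k hk
  calc ∫⁻ x : E, ENNReal.ofReal (‖x‖ ^ ℓ) * ‖iteratedFDeriv ℝ k f x‖ₑ
      ≤ ∫⁻ x : E, ENNReal.ofReal C * ENNReal.ofReal (‖x‖ ^ ℓ * (1 + ‖x‖) ^ (-a)) := by
        refine lintegral_mono fun x => ?_
        rw [← ofReal_norm, ← ENNReal.ofReal_mul (by positivity), ← ENNReal.ofReal_mul hC]
        refine ENNReal.ofReal_le_ofReal ?_
        calc _ ≤ ‖x‖ ^ ℓ * (C * (1 + ‖x‖) ^ (-a)) := by gcongr; exact hb x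
          _ = _ := by ring
    _ < ⊤ := by
        rw [lintegral_const_mul' _ _ ENNReal.ofReal_ne_top]
        exact ENNReal.mul_lt_top ENNReal.ofReal_lt_top
          (lintegral_rpow_mul_one_add_norm_lt_top hℓ h)

theorem HasDecay.integrable {n : ℕ} {a : ℝ} {f : E → F} (hf : HasDecay n a f)
    (h : Module.finrank ℝ E < a) : Integrable f := by
  obtain ⟨C, hC, hb⟩ := hf.exists_norm_apply_le
  exact ((integrable_one_add_norm h).const_mul C).mono'
    hf.contDiff.continuous.aestronglyMeasurable (Eventually.of_forall hb)

theorem lintegral_rpow_mul_conv_le {f U : E → ℝ≥0∞} (hf : Measurable f) (hU : AEMeasurable U)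
    {ℓ : ℝ} (hℓ : 0 ≤ ℓ) :
    ∫⁻ x, ENNReal.ofReal (‖x‖ ^ ℓ) * ∫⁻ y, U y * f (x - y) ≤
      ENNReal.ofReal (2 ^ ℓ) * ((∫⁻ x, ENNReal.ofReal (‖x‖ ^ ℓ) * f x) * (∫⁻ y, U y) +
        (∫⁻ x, f x) * ∫⁻ y, ENNReal.ofReal (‖y‖ ^ ℓ) * U y) := by
  have hw : Measurable fun x : E => ENNReal.ofReal (‖x‖ ^ ℓ) :=
    (measurable_norm.pow_const ℓ).ennreal_ofReal
  have hfs : Measurable fun p : E × E => f (p.1 - p.2) :=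
    hf.comp (measurable_fst.sub measurable_snd)
  have hwf : Measurable fun x : E => ENNReal.ofReal (‖x‖ ^ ℓ) * f x := hw.mul hf
  have hwU : AEMeasurable fun x : E => ENNReal.ofReal (‖x‖ ^ ℓ) * U x := hw.aemeasurable.mul hU
  calc ∫⁻ x, ENNReal.ofReal (‖x‖ ^ ℓ) * ∫⁻ y, U y * f (x - y)
      = ∫⁻ x, ∫⁻ y, ENNReal.ofReal (‖x‖ ^ ℓ) * (U y * f (x - y)) := by
        refine lintegral_congr fun x => ?_
        rw [lintegral_const_mul' _ _ ENNReal.ofReal_ne_top]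
    _ = ∫⁻ y, ∫⁻ x, ENNReal.ofReal (‖x‖ ^ ℓ) * (U y * f (x - y)) := by
        refine lintegral_lintegral_swap ?_
        exact (hw.comp measurable_fst).aemeasurable.mul
          ((hU.comp_snd).mul hfs.aemeasurable)
    _ = ∫⁻ y, ∫⁻ x, ENNReal.ofReal (‖x + y‖ ^ ℓ) * (U y * f x) := by
        refine lintegral_congr fun y => ?_
        rw [← lintegral_add_right_eq_self _ y]
        simp
    _ ≤ ∫⁻ y, ∫⁻ x, ENNReal.ofReal (2 ^ ℓ) * (U y * (ENNReal.ofReal (‖x‖ ^ ℓ) * f x) +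
          (ENNReal.ofReal (‖y‖ ^ ℓ) * U y) * f x) := by
        refine lintegral_mono fun y => lintegral_mono fun x => ?_
        have : ENNReal.ofReal (‖x + y‖ ^ ℓ) ≤
            ENNReal.ofReal (2 ^ ℓ) * (ENNReal.ofReal (‖x‖ ^ ℓ) + ENNReal.ofReal (‖y‖ ^ ℓ)) := by
          rw [← ENNReal.ofReal_add (by positivity) (by positivity),
            ← ENNReal.ofReal_mul (by positivity)]
          refine ENNReal.ofReal_le_ofReal (le_trans ?_
            (add_rpow_le_two_rpow_mul (norm_nonneg x) (norm_nonneg y) hℓ))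
          gcongr
          exact norm_add_le x y
        calc _ ≤ ENNReal.ofReal (2 ^ ℓ) * (ENNReal.ofReal (‖x‖ ^ ℓ) +
              ENNReal.ofReal (‖y‖ ^ ℓ)) * (U y * f x) := by gcongr
          _ = _ := by ring
    _ = ∫⁻ y, ENNReal.ofReal (2 ^ ℓ) * (U y * (∫⁻ x, ENNReal.ofReal (‖x‖ ^ ℓ) * f x) +
          (ENNReal.ofReal (‖y‖ ^ ℓ) * U y) * ∫⁻ x, f x) := by
        refine lintegral_congr fun y => ?_
        rw [lintegral_const_mul' _ _ ENNReal.ofReal_ne_top,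
          lintegral_add_left ((hwf).const_mul _), lintegral_const_mul _ hwf,
          lintegral_const_mul _ hf]
    _ = _ := by
        rw [lintegral_const_mul' _ _ ENNReal.ofReal_ne_top,
          lintegral_add_left' (hU.mul_const _), lintegral_mul_const'' _ hU,
          lintegral_mul_const'' _ hwU]
        ring

end General

section Dilation

variable {E : Type*} [NormedAddCommGroup E] [NormedSpace ℝ E]

/-- The `L¹`-normalised dilation `s^{-dim E} g(x / s)`. -/
noncomputable def dil (g : E → ℝ) (s : ℝ) (x : E) : ℝ :=
  (s ^ Module.finrank ℝ E)⁻¹ * g (s⁻¹ • x)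

theorem contDiff_dil {n : ℕ} {g : E → ℝ} (hg : ContDiff ℝ n g) (s : ℝ) :
    ContDiff ℝ n (dil g s) :=
  contDiff_const.mul (hg.comp (contDiff_const_smul s⁻¹))

theorem norm_iteratedFDeriv_dil {n : ℕ} {g : E → ℝ} (hg : ContDiff ℝ n g) {s : ℝ} (hs : 0 < s)
    {j : ℕ} (hj : j ≤ n) (x : E) :
    ‖iteratedFDeriv ℝ j (dil g s) x‖ =
      (s ^ (Module.finrank ℝ E + j))⁻¹ * ‖iteratedFDeriv ℝ j g (s⁻¹ • x)‖ := by
  have hj' : ContDiff ℝ j g := hg.of_le (by exact_mod_cast hj)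
  have h1 : dil g s = fun x => (s ^ Module.finrank ℝ E)⁻¹ • g (s⁻¹ • x) := rfl
  have h2 : ContDiff ℝ j fun x => g (s⁻¹ • x) := hj'.comp (contDiff_const_smul s⁻¹)
  rw [h1, iteratedFDeriv_const_smul_apply' h2.contDiffAt,
    iteratedFDeriv_comp_const_smul _ hj', norm_smul, norm_smul, pow_add, norm_inv, norm_pow,
    norm_pow, norm_inv, Real.norm_of_nonneg hs.le, mul_inv, inv_pow, mul_assoc]

theorem HasDecay.dilation {n : ℕ} {a : ℝ} {g : E → ℝ} (hg : HasDecay n a g) (ha : 0 ≤ a) {s : ℝ}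
    (hs : 0 < s) : HasDecay n a (dil g s) := by
  refine ⟨contDiff_dil hg.contDiff s, fun k hk => ?_⟩
  obtain ⟨C, hC, hb⟩ := hg.bound k hk
  have hm : 0 < max 1 s := lt_max_of_lt_left one_pos
  refine ⟨(s ^ (Module.finrank ℝ E + k))⁻¹ * (C * max 1 s ^ a), by positivity, fun x => ?_⟩
  rw [norm_iteratedFDeriv_dil hg.contDiff hs hk, mul_assoc, mul_assoc]
  refine mul_le_mul_of_nonneg_left ((hb _).trans (mul_le_mul_of_nonneg_left ?_ hC))
    (by positivity)
  have h1 : 1 + ‖x‖ ≤ max 1 s * (1 + ‖s⁻¹ • x‖) := by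
    rw [norm_smul, norm_inv, Real.norm_of_nonneg hs.le, mul_add, mul_one]
    have h2 : ‖x‖ = s * (s⁻¹ * ‖x‖) := by field_simp
    have h3 : s * (s⁻¹ * ‖x‖) ≤ max 1 s * (s⁻¹ * ‖x‖) := by
      gcongr
      exact le_max_right _ _
    linarith [le_max_left 1 s]
  rw [Real.rpow_neg (by positivity), Real.rpow_neg (by positivity), inv_le_iff_one_le_mul₀
    (by positivity), mul_right_comm, ← div_eq_mul_inv, one_le_div (by positivity),
    ← Real.mul_rpow (by positivity) (by positivity)]
  exact Real.rpow_le_rpow (by positivity) h1 ha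

variable [MeasureSpace E] [BorelSpace E] [FiniteDimensional ℝ E]
  [(volume : Measure E).IsAddHaarMeasure]

theorem lintegral_comp_inv_smul {f : E → ℝ≥0∞} (hf : Measurable f) {s : ℝ} (hs : 0 < s) :
    ∫⁻ x, f (s⁻¹ • x) = ENNReal.ofReal (s ^ Module.finrank ℝ E) * ∫⁻ x, f x := by
  rw [← lintegral_map hf (measurable_const_smul s⁻¹),
    Measure.map_addHaar_smul _ (inv_ne_zero hs.ne'), lintegral_smul_measure, smul_eq_mul,
    inv_pow, inv_inv, abs_of_pos (by positivity)]

theorem lintegral_rpow_mul_iteratedFDeriv_dil {n : ℕ} {g : E → ℝ} (hg : ContDiff ℝ n g) {s : ℝ}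
    (hs : 0 < s) {j : ℕ} (hj : j ≤ n) (ℓ : ℝ) :
    ∫⁻ x, ENNReal.ofReal (‖x‖ ^ ℓ) * ‖iteratedFDeriv ℝ j (dil g s) x‖ₑ =
      ENNReal.ofReal (s ^ (ℓ - j)) *
        ∫⁻ x, ENNReal.ofReal (‖x‖ ^ ℓ) * ‖iteratedFDeriv ℝ j g x‖ₑ := by
  have hm : Measurable fun x : E => ENNReal.ofReal (‖x‖ ^ ℓ) * ‖iteratedFDeriv ℝ j g x‖ₑ :=
    (measurable_norm.pow_const ℓ).ennreal_ofReal.mul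
      (hg.continuous_iteratedFDeriv (by exact_mod_cast hj)).enorm.measurable
  have h : ∀ x : E, ENNReal.ofReal (‖x‖ ^ ℓ) * ‖iteratedFDeriv ℝ j (dil g s) x‖ₑ =
      ENNReal.ofReal (s ^ ℓ * (s ^ (Module.finrank ℝ E + j))⁻¹) *
        (ENNReal.ofReal (‖s⁻¹ • x‖ ^ ℓ) * ‖iteratedFDeriv ℝ j g (s⁻¹ • x)‖ₑ) := fun x => by
    rw [← ofReal_norm, ← ofReal_norm, norm_iteratedFDeriv_dil hg hs hj,
      ← ENNReal.ofReal_mul (by positivity), ← ENNReal.ofReal_mul (by positivity),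
      ← ENNReal.ofReal_mul (by positivity), norm_smul, norm_inv, Real.norm_of_nonneg hs.le,
      Real.mul_rpow (by positivity) (by positivity), Real.inv_rpow hs.le]
    congr 1
    field_simp
  simp_rw [h]
  rw [lintegral_const_mul' _ _ ENNReal.ofReal_ne_top,
    lintegral_comp_inv_smul (f := fun x => ENNReal.ofReal (‖x‖ ^ ℓ) * ‖iteratedFDeriv ℝ j g x‖ₑ)
      hm hs, ← mul_assoc, ← ENNReal.ofReal_mul (by positivity)]
  congr 2
  rw [Real.rpow_sub hs, Real.rpow_natCast, pow_add]
  field_simp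

end Dilation

section Taylor

variable {E : Type*} [NormedAddCommGroup E] [NormedSpace ℝ E]

/-- The remainder of order `m` in the Taylor expansion of `g (z - η)` at `η = 0`. -/
noncomputable def taylorRem (g : E → ℝ) (m : ℕ) (z η : E) : ℝ :=
  g (z - η) - ∑ k ∈ Finset.range (m + 1),
    (k.factorial : ℝ)⁻¹ * iteratedFDeriv ℝ k g z fun _ => -η

theorem HasDecay.norm_taylorRem_le_of_norm_le_one {m : ℕ} {a : ℝ} {g : E → ℝ}
    (hg : HasDecay (m + 1) a g) (ha : 0 ≤ a) :
    ∃ C, 0 ≤ C ∧ ∀ z η, ‖η‖ ≤ 1 →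
      ‖taylorRem g m z η‖ ≤ C * ‖η‖ ^ (m + 1) * (1 + ‖z‖) ^ (-a) := by
  obtain ⟨C, hC, hb⟩ := hg.bound (m + 1) le_rfl
  refine ⟨C * 2 ^ a, by positivity, fun z η hη => ?_⟩
  have h := map_add_eq_sum_add_integral_iteratedFDeriv (f := g) (x := z) (y := -η) (n := m)
    fun t _ => by simpa using hg.contDiff.contDiffAt
  have h1 : taylorRem g m z η = (m.factorial : ℝ)⁻¹ • ∫ t in (0 : ℝ)..1,
      (1 - t) ^ m • iteratedFDeriv ℝ (m + 1) g (z + t • -η) (fun _ ↦ -η) := by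
    rw [taylorRem, sub_eq_add_neg z, h]
    simp
  have h2 : ‖∫ t in (0 : ℝ)..1,
      (1 - t) ^ m • iteratedFDeriv ℝ (m + 1) g (z + t • -η) (fun _ ↦ -η)‖ ≤
      C * 2 ^ a * ‖η‖ ^ (m + 1) * (1 + ‖z‖) ^ (-a) * |1 - 0| := by
    refine intervalIntegral.norm_integral_le_of_norm_le_const fun t ht => ?_
    rw [Set.uIoc_of_le zero_le_one] at ht
    have h3 : ‖iteratedFDeriv ℝ (m + 1) g (z + t • -η) (fun _ ↦ -η)‖ ≤
        ‖iteratedFDeriv ℝ (m + 1) g (z + t • -η)‖ * ‖η‖ ^ (m + 1) := by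
      simpa using (iteratedFDeriv ℝ (m + 1) g (z + t • -η)).le_opNorm (fun _ ↦ -η)
    have h4 : (1 + ‖z‖) / 2 ≤ 1 + ‖z + t • -η‖ := by
      have h5 : ‖z‖ ≤ ‖z + t • -η‖ + ‖t • -η‖ := by
        simpa using norm_sub_le (z + t • -η) (t • -η)
      have h6 : ‖t • -η‖ ≤ 1 := by
        rw [norm_smul, norm_neg, Real.norm_of_nonneg ht.1.le]
        nlinarith [norm_nonneg η, ht.1, ht.2]
      linarith [norm_nonneg (z + t • -η)]
    have h7 : (1 + ‖z + t • -η‖) ^ (-a) ≤ 2 ^ a * (1 + ‖z‖) ^ (-a) := by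
      calc _ ≤ ((1 + ‖z‖) / 2) ^ (-a) :=
            Real.rpow_le_rpow_of_nonpos (by positivity) h4 (by linarith)
        _ = _ := by
            rw [Real.div_rpow (by positivity) (by norm_num), Real.rpow_neg (by norm_num : (0:ℝ) ≤ 2)]
            field_simp
    have h8 : ‖(1 - t) ^ m‖ ≤ 1 := by
      rw [norm_pow]
      exact pow_le_one₀ (norm_nonneg _) (by rw [Real.norm_of_nonneg] <;> linarith [ht.1, ht.2])
    calc _ ≤ 1 * (‖iteratedFDeriv ℝ (m + 1) g (z + t • -η)‖ * ‖η‖ ^ (m + 1)) := by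
          rw [norm_smul]; gcongr
      _ ≤ 1 * (C * (2 ^ a * (1 + ‖z‖) ^ (-a)) * ‖η‖ ^ (m + 1)) := by
          gcongr
          exact (hb _).trans (by gcongr)
      _ = _ := by ring
  rw [h1, norm_smul]
  have h9 : ‖(m.factorial : ℝ)⁻¹‖ ≤ 1 := by
    rw [norm_inv, Real.norm_natCast]
    exact inv_le_one_of_one_le₀ (by exact_mod_cast m.factorial_pos)
  simp only [sub_zero, abs_one, mul_one] at h2
  calc _ ≤ 1 * _ := mul_le_mul h9 h2 (norm_nonneg _) zero_le_one
    _ = _ := one_mul _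

/-- Weighted pointwise bound for the Taylor remainder, uniform in the increment. -/
theorem HasDecay.rpow_mul_norm_taylorRem_le {m : ℕ} {a ℓ K : ℝ} {g : E → ℝ}
    (hg : HasDecay (m + 1) a g) (ha : 0 ≤ a) (hℓ : 0 ≤ ℓ) (hℓK : ℓ ≤ K) (hmK : m ≤ K)
    (hKm : K ≤ m + 1) :
    ∃ C, 0 ≤ C ∧ ∀ z η, ‖z‖ ^ ℓ * ‖taylorRem g m z η‖ ≤
      C * ‖η‖ ^ K * ((1 + ‖z - η‖) ^ (-(a - ℓ)) + (1 + ‖z‖) ^ (-(a - ℓ))) := by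
  obtain ⟨C₁, hC₁, h1⟩ := hg.norm_taylorRem_le_of_norm_le_one ha
  obtain ⟨C₀, hC₀, h0⟩ := hg.exists_norm_apply_le
  have hk : ∀ k : ℕ, ∃ C, 0 ≤ C ∧ ∀ x, k ≤ m → ‖iteratedFDeriv ℝ k g x‖ ≤ C * (1 + ‖x‖) ^ (-a) := by
    intro k
    by_cases hkm : k ≤ m
    · obtain ⟨C, hC, hb⟩ := hg.bound k (by omega)
      exact ⟨C, hC, fun x _ => hb x⟩
    · exact ⟨0, le_rfl, fun x h => absurd h hkm⟩
  choose c hc hcb using hk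
  have hS : 0 ≤ ∑ k ∈ Finset.range (m + 1), c k := Finset.sum_nonneg fun k _ => hc k
  refine ⟨C₁ + 2 ^ ℓ * 2 * C₀ + ∑ k ∈ Finset.range (m + 1), c k, by positivity, fun z η => ?_⟩
  have hz := rpow_mul_one_add_rpow_neg_le (a := a) (norm_nonneg z) hℓ
  rcases le_total ‖η‖ 1 with hη | hη
  · have hpow : ‖η‖ ^ (m + 1) ≤ ‖η‖ ^ K := by
      rcases eq_or_lt_of_le (norm_nonneg η) with h | h
      · rw [← h, zero_pow (by omega)]
        positivity
      · rw [← Real.rpow_natCast]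
        exact Real.rpow_le_rpow_of_exponent_ge h hη (by simpa using hKm)
    calc ‖z‖ ^ ℓ * ‖taylorRem g m z η‖
        ≤ ‖z‖ ^ ℓ * (C₁ * ‖η‖ ^ (m + 1) * (1 + ‖z‖) ^ (-a)) := by
          gcongr
          exact h1 z η hη
      _ = C₁ * ‖η‖ ^ (m + 1) * (‖z‖ ^ ℓ * (1 + ‖z‖) ^ (-a)) := by ring
      _ ≤ (C₁ + 2 ^ ℓ * 2 * C₀ + ∑ k ∈ Finset.range (m + 1), c k) * ‖η‖ ^ K *
          (0 + (1 + ‖z‖) ^ (-(a - ℓ))) := by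
          rw [zero_add]
          gcongr
          rw [add_assoc]
          exact le_add_of_nonneg_right (by positivity)
      _ ≤ _ := by
          gcongr
          positivity
  · have hηℓ : ‖η‖ ^ ℓ ≤ ‖η‖ ^ K := Real.rpow_le_rpow_of_exponent_le hη hℓK
    have hmain : ‖z‖ ^ ℓ * ‖g (z - η)‖ ≤
        2 ^ ℓ * 2 * C₀ * ‖η‖ ^ K * (1 + ‖z - η‖) ^ (-(a - ℓ)) := by
      have e1 : ‖z‖ ^ ℓ ≤ 2 ^ ℓ * (‖z - η‖ ^ ℓ + ‖η‖ ^ ℓ) := by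
        refine le_trans ?_ (add_rpow_le_two_rpow_mul (norm_nonneg _) (norm_nonneg _) hℓ)
        gcongr
        simpa using norm_add_le (z - η) η
      have e2 := rpow_mul_one_add_rpow_neg_le (a := a) (norm_nonneg (z - η)) hℓ
      have e3 : (1 + ‖z - η‖) ^ (-a) ≤ (1 + ‖z - η‖) ^ (-(a - ℓ)) :=
        Real.rpow_le_rpow_of_exponent_le (by linarith [norm_nonneg (z - η)]) (by linarith)
      have e4 : 1 ≤ ‖η‖ ^ K := Real.one_le_rpow hη (hℓ.trans hℓK)
      calc _ ≤ 2 ^ ℓ * (‖z - η‖ ^ ℓ + ‖η‖ ^ ℓ) * (C₀ * (1 + ‖z - η‖) ^ (-a)) := by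
            gcongr
            exact h0 _
        _ = 2 ^ ℓ * C₀ * (1 * (‖z - η‖ ^ ℓ * (1 + ‖z - η‖) ^ (-a)) +
              ‖η‖ ^ ℓ * (1 + ‖z - η‖) ^ (-a)) := by ring
        _ ≤ 2 ^ ℓ * C₀ * (‖η‖ ^ K * (1 + ‖z - η‖) ^ (-(a - ℓ)) +
              ‖η‖ ^ K * (1 + ‖z - η‖) ^ (-(a - ℓ))) := by gcongr
        _ = _ := by ring
    have hterm : ∀ k ∈ Finset.range (m + 1), ‖z‖ ^ ℓ *
        ‖(k.factorial : ℝ)⁻¹ * iteratedFDeriv ℝ k g z fun _ => -η‖ ≤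
          c k * (‖η‖ ^ K * (1 + ‖z‖) ^ (-(a - ℓ))) := by
      intro k hk
      have hkm : k ≤ m := by simpa [Nat.lt_succ_iff] using hk
      have e1 : ‖iteratedFDeriv ℝ k g z fun _ => -η‖ ≤ ‖iteratedFDeriv ℝ k g z‖ * ‖η‖ ^ k := by
        simpa using (iteratedFDeriv ℝ k g z).le_opNorm (fun _ ↦ -η)
      have e2 : ‖η‖ ^ k ≤ ‖η‖ ^ K := by
        rw [← Real.rpow_natCast]
        exact Real.rpow_le_rpow_of_exponent_le hη ((Nat.cast_le.2 hkm).trans hmK)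
      have e3 : ‖(k.factorial : ℝ)⁻¹‖ ≤ 1 := by
        rw [norm_inv, Real.norm_natCast]
        exact inv_le_one_of_one_le₀ (by exact_mod_cast k.factorial_pos)
      calc _ ≤ ‖z‖ ^ ℓ * (1 * (c k * (1 + ‖z‖) ^ (-a) * ‖η‖ ^ K)) := by
            rw [norm_mul]
            gcongr
            have := hc k
            exact e1.trans (mul_le_mul (hcb k z hkm) e2 (by positivity) (by positivity))
        _ = c k * (‖η‖ ^ K * (‖z‖ ^ ℓ * (1 + ‖z‖) ^ (-a))) := by ring
        _ ≤ _ := by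
            have := hc k
            gcongr
    calc ‖z‖ ^ ℓ * ‖taylorRem g m z η‖
        ≤ ‖z‖ ^ ℓ * (‖g (z - η)‖ + ∑ k ∈ Finset.range (m + 1),
            ‖(k.factorial : ℝ)⁻¹ * iteratedFDeriv ℝ k g z fun _ => -η‖) := by
          gcongr
          exact (norm_sub_le _ _).trans (by gcongr; exact norm_sum_le _ _)
      _ ≤ 2 ^ ℓ * 2 * C₀ * ‖η‖ ^ K * (1 + ‖z - η‖) ^ (-(a - ℓ)) +
          ∑ k ∈ Finset.range (m + 1), c k * (‖η‖ ^ K * (1 + ‖z‖) ^ (-(a - ℓ))) := by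
          rw [mul_add, Finset.mul_sum]
          exact add_le_add hmain (Finset.sum_le_sum hterm)
      _ ≤ _ := by
          rw [← Finset.sum_mul]
          have p1 : 0 ≤ ‖η‖ ^ K * (1 + ‖z - η‖) ^ (-(a - ℓ)) := by positivity
          have p2 : 0 ≤ ‖η‖ ^ K * (1 + ‖z‖) ^ (-(a - ℓ)) := by positivity
          have q1 := mul_nonneg (add_nonneg hC₁ hS) p1
          have q2 := mul_nonneg (add_nonneg hC₁ (by positivity : 0 ≤ 2 ^ ℓ * 2 * C₀)) p2
          linarith

end Taylor

section Smoothing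

variable {E : Type*} [NormedAddCommGroup E] [NormedSpace ℝ E] [MeasureSpace E] [BorelSpace E]
  [FiniteDimensional ℝ E] [(volume : Measure E).IsAddHaarMeasure]

theorem HasDecay.exists_lintegral_rpow_mul_iteratedFDeriv_conv_dil_le {n : ℕ} {a ℓ : ℝ} {g : E → ℝ}
    (hg : HasDecay n a g) (hℓ : 0 ≤ ℓ) (h : Module.finrank ℝ E + ℓ < a) {j : ℕ} (hj : j ≤ n) :
    ∃ C : ℝ≥0∞, C ≠ ⊤ ∧ ∀ s : ℝ, 0 < s → ∀ u : E → ℝ, Integrable u →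
      ∫⁻ x, ENNReal.ofReal (‖x‖ ^ ℓ) * ‖iteratedFDeriv ℝ j (conv (dil g s) u) x‖ₑ ≤
        C * ENNReal.ofReal (s ^ (-(j : ℝ))) * (ENNReal.ofReal (s ^ ℓ) * (∫⁻ y, ‖u y‖ₑ) +
          ∫⁻ y, ENNReal.ofReal (‖y‖ ^ ℓ) * ‖u y‖ₑ) := by
  have hD : (0 : ℝ) ≤ Module.finrank ℝ E := Nat.cast_nonneg _
  have ha : 0 ≤ a := by linarith
  set A : ℝ → ℝ≥0∞ := fun p => ∫⁻ x, ENNReal.ofReal (‖x‖ ^ p) * ‖iteratedFDeriv ℝ j g x‖ₑ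
  have hAℓ : A ℓ < ⊤ := hg.lintegral_rpow_lt_top hℓ h hj
  have hA0 : A 0 < ⊤ := hg.lintegral_rpow_lt_top le_rfl (by linarith) hj
  refine ⟨ENNReal.ofReal (2 ^ ℓ) * (A ℓ + A 0),
    ENNReal.mul_ne_top ENNReal.ofReal_ne_top (ENNReal.add_ne_top.2 ⟨hAℓ.ne, hA0.ne⟩),
    fun s hs u hu => ?_⟩
  have hs' := hg.dilation ha hs
  have hcont : Continuous (iteratedFDeriv ℝ j (dil g s)) :=
    hs'.contDiff.continuous_iteratedFDeriv (by exact_mod_cast hj)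
  have e := lintegral_rpow_mul_conv_le (f := fun x => ‖iteratedFDeriv ℝ j (dil g s) x‖ₑ)
    (U := fun y => ‖u y‖ₑ) hcont.enorm.measurable hu.1.enorm hℓ
  have e0 := lintegral_rpow_mul_iteratedFDeriv_dil hg.contDiff hs hj 0
  simp only [Real.rpow_zero, ENNReal.ofReal_one, one_mul, zero_sub] at e0
  rw [lintegral_rpow_mul_iteratedFDeriv_dil hg.contDiff hs hj ℓ, e0] at e
  have hA0' : A 0 = ∫⁻ x, ‖iteratedFDeriv ℝ j g x‖ₑ := by simp [A]
  rw [← hA0', sub_eq_neg_add, Real.rpow_add hs, ENNReal.ofReal_mul (by positivity)] at e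
  rw [hs'.iteratedFDeriv_conv ha hu hj]
  refine (lintegral_mono fun x => mul_le_mul_right (enorm_conv_le _ u x) _).trans (e.trans ?_)
  change _ * (_ * A ℓ * _ + _) ≤ _
  set S := ENNReal.ofReal (s ^ (-(j : ℝ)))
  set V := ∫⁻ y, ‖u y‖ₑ
  set Vℓ := ∫⁻ y, ENNReal.ofReal (‖y‖ ^ ℓ) * ‖u y‖ₑ
  calc _ = ENNReal.ofReal (2 ^ ℓ) * S * (A ℓ * (ENNReal.ofReal (s ^ ℓ) * V) + A 0 * Vℓ) := by ring
    _ ≤ ENNReal.ofReal (2 ^ ℓ) * S *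
        ((A ℓ + A 0) * (ENNReal.ofReal (s ^ ℓ) * V) + (A ℓ + A 0) * Vℓ) := by
      gcongr
      · exact le_self_add
      · exact le_add_self
    _ = _ := by ring

theorem HasDecay.exists_eLpNorm_iteratedFDeriv_conv_dil_le {n : ℕ} {a : ℝ} {g : E → ℝ}
    (hg : HasDecay n a g) (h : Module.finrank ℝ E < a) {j : ℕ} (hj : j ≤ n) {q : ℝ≥0∞}
    (hq : 1 ≤ q) :
    ∃ C : ℝ≥0∞, C ≠ ⊤ ∧ ∀ s : ℝ, 0 < s → ∀ u : E → ℝ, Integrable u →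
      eLpNorm (iteratedFDeriv ℝ j (conv (dil g s) u)) q ≤
        C * ENNReal.ofReal (s ^ (-(Module.finrank ℝ E * (1 - q.toReal⁻¹) + j))) *
          ∫⁻ y, ‖u y‖ₑ := by
  have hD : (0 : ℝ) ≤ Module.finrank ℝ E := Nat.cast_nonneg _
  have ha : 0 ≤ a := by linarith
  obtain ⟨C, hC, hb⟩ := hg.exists_lintegral_rpow_mul_iteratedFDeriv_conv_dil_le le_rfl
    (by simpa using h) hj
  obtain ⟨B, hB, hgB⟩ := hg.exists_norm_le ha hj
  set p := q.toReal⁻¹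
  have hp0 : 0 ≤ p := by positivity
  have hp1 : p ≤ 1 := by
    rcases eq_or_ne q ⊤ with hq' | hq'
    · simp [p, hq']
    · exact inv_le_one_of_one_le₀ (by simpa using (ENNReal.toReal_le_toReal (by simp) hq').2 hq)
  refine ⟨(2 * C) ^ p * ENNReal.ofReal B ^ (1 - p), ENNReal.mul_ne_top
    (ENNReal.rpow_ne_top_of_nonneg hp0 (ENNReal.mul_ne_top (by simp) hC))
    (ENNReal.rpow_ne_top_of_nonneg (by linarith) ENNReal.ofReal_ne_top), fun s hs u hu => ?_⟩
  have hs' := hg.dilation ha hs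
  set V := ∫⁻ y, ‖u y‖ₑ with hV
  have hVt : V ≠ ⊤ := hu.2.ne
  have hsup : ∀ x, ‖iteratedFDeriv ℝ j (conv (dil g s) u) x‖ₑ ≤
      ENNReal.ofReal B * ENNReal.ofReal (s ^ (-(Module.finrank ℝ E + j : ℝ))) * V := by
    intro x
    rw [hs'.iteratedFDeriv_conv ha hu hj]
    refine (enorm_conv_le _ u x).trans ?_
    rw [mul_comm _ V, ← lintegral_mul_const' _ _ (by finiteness)]
    refine lintegral_mono fun y => mul_le_mul_right ?_ _
    rw [← ofReal_norm, norm_iteratedFDeriv_dil hg.contDiff hs hj, ← ENNReal.ofReal_mul hB]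
    apply ENNReal.ofReal_le_ofReal
    rw [mul_comm, Real.rpow_neg hs.le, ← Nat.cast_add, Real.rpow_natCast]
    gcongr
    exact hgB _
  have hone : ∫⁻ x, ‖iteratedFDeriv ℝ j (conv (dil g s) u) x‖ₑ ≤
      2 * C * ENNReal.ofReal (s ^ (-(j : ℝ))) * V := by
    have := hb s hs u hu
    simp only [Real.rpow_zero, ENNReal.ofReal_one, one_mul] at this
    exact this.trans_eq (by ring)
  refine (eLpNorm_le_interpolate (by finiteness) hsup hone hq).trans_eq ?_
  change _ ^ p * _ ^ (1 - p) = _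
  generalize 2 * C = C₁
  generalize ENNReal.ofReal B = B₁
  rw [ENNReal.mul_rpow_of_nonneg _ _ hp0, ENNReal.mul_rpow_of_nonneg _ _ hp0,
    ENNReal.mul_rpow_of_nonneg _ _ (sub_nonneg.2 hp1),
    ENNReal.mul_rpow_of_nonneg _ _ (sub_nonneg.2 hp1),
    ENNReal.ofReal_rpow_of_pos (by positivity), ENNReal.ofReal_rpow_of_pos (by positivity),
    ← Real.rpow_mul hs.le, ← Real.rpow_mul hs.le]
  have hV1 : V ^ p * V ^ (1 - p) = V := by
    rw [← ENNReal.rpow_add_of_nonneg _ _ hp0 (by linarith), add_sub_cancel, ENNReal.rpow_one]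
  have hs1 : ENNReal.ofReal (s ^ (-(j : ℝ) * p)) *
      ENNReal.ofReal (s ^ (-(Module.finrank ℝ E + j : ℝ) * (1 - p))) =
      ENNReal.ofReal (s ^ (-(Module.finrank ℝ E * (1 - p) + j))) := by
    rw [← ENNReal.ofReal_mul (by positivity), ← Real.rpow_add hs]
    congr 2
    ring
  rw [← hs1]
  nth_rewrite 3 [← hV1]
  ring

end Smoothing

section Moments

variable {E : Type*} [NormedAddCommGroup E] [NormedSpace ℝ E] [MeasureSpace E] [BorelSpace E]

theorem pow_le_one_add_rpow {r K : ℝ} (hr : 0 ≤ r) {k : ℕ} (hk : k ≤ K) : r ^ k ≤ 1 + r ^ K := by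
  rcases le_total r 1 with h | h
  · exact (pow_le_one₀ hr h).trans (le_add_of_nonneg_right (by positivity))
  · rw [← Real.rpow_natCast]
    exact (Real.rpow_le_rpow_of_exponent_le h hk).trans (by linarith)

theorem integrable_mul_multilinear {K : ℝ} {ψ : E → ℝ} (hψ : Integrable ψ)
    (hψK : Integrable fun y => ‖y‖ ^ K * ψ y) {k : ℕ} (hk : k ≤ K) (T : E [×k]→L[ℝ] ℝ) :
    Integrable fun y => ψ y * T fun _ => y := by
  have hT : Continuous fun y => T fun _ : Fin k => y := by fun_prop
  refine ((hψ.norm.add hψK.norm).const_mul ‖T‖).mono' (hψ.1.mul hT.aestronglyMeasurable)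
    (Eventually.of_forall fun y => ?_)
  have h1 : ‖T fun _ : Fin k => y‖ ≤ ‖T‖ * ‖y‖ ^ k := by simpa using T.le_opNorm fun _ => y
  have h2 := pow_le_one_add_rpow (norm_nonneg y) hk
  have h3 : ‖‖y‖ ^ K * ψ y‖ = ‖y‖ ^ K * ‖ψ y‖ := by
    rw [norm_mul, Real.norm_of_nonneg (by positivity)]
  simp only [Pi.add_apply, h3]
  rw [norm_mul]
  calc _ ≤ ‖ψ y‖ * (‖T‖ * (1 + ‖y‖ ^ K)) := by
        gcongr
        exact h1.trans (by gcongr)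
    _ = _ := by ring

theorem conv_dil_eq_integral_taylorRem {m : ℕ} {K : ℝ} {g : E → ℝ} (hg : Continuous g) {B : ℝ}
    (hB : ∀ x, ‖g x‖ ≤ B) (hm : m ≤ K) {ψ : E → ℝ} (hψ : Integrable ψ)
    (hψK : Integrable fun y => ‖y‖ ^ K * ψ y)
    (hψ0 : ∀ k ≤ m, ∀ T : E [×k]→L[ℝ] ℝ, ∫ y, ψ y * T (fun _ => y) = 0) {s : ℝ} (x : E) :
    conv (dil g s) ψ x =
      ∫ y, (s ^ Module.finrank ℝ E)⁻¹ * (ψ y * taylorRem g m (s⁻¹ • x) (s⁻¹ • y)) := by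
  have hkK : ∀ k ∈ Finset.range (m + 1), k ≤ m := fun k hk => by
    simpa [Nat.lt_succ_iff] using hk
  have hterm : ∀ k y, ψ y * ((k.factorial : ℝ)⁻¹ *
      iteratedFDeriv ℝ k g (s⁻¹ • x) fun _ => -(s⁻¹ • y)) =
      ((k.factorial : ℝ)⁻¹ * (-s⁻¹) ^ k) * (ψ y * iteratedFDeriv ℝ k g (s⁻¹ • x) fun _ => y) := by
    intro k y
    have := (iteratedFDeriv ℝ k g (s⁻¹ • x)).map_smul_univ (fun _ => -s⁻¹) (fun _ => y)
    simp only [neg_smul, Finset.prod_const, Finset.card_univ, Fintype.card_fin, smul_eq_mul] at this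
    rw [this]
    ring
  have hsum : ∫ y, ψ y * ∑ k ∈ Finset.range (m + 1), (k.factorial : ℝ)⁻¹ *
      iteratedFDeriv ℝ k g (s⁻¹ • x) (fun _ => -(s⁻¹ • y)) = 0 := by
    simp_rw [Finset.mul_sum, hterm]
    rw [integral_finsetSum _ fun k hk => (integrable_mul_multilinear hψ hψK
      ((Nat.cast_le.2 (hkK k hk)).trans hm) _).const_mul _]
    refine Finset.sum_eq_zero fun k hk => ?_
    rw [integral_const_mul, hψ0 k (hkK k hk), mul_zero]
  have hint : Integrable fun y => ψ y * ∑ k ∈ Finset.range (m + 1), (k.factorial : ℝ)⁻¹ *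
      iteratedFDeriv ℝ k g (s⁻¹ • x) (fun _ => -(s⁻¹ • y)) := by
    simp_rw [Finset.mul_sum, hterm]
    exact integrable_finsetSum _ fun k hk => (integrable_mul_multilinear hψ hψK
      ((Nat.cast_le.2 (hkK k hk)).trans hm) _).const_mul _
  have hint' : Integrable fun y => ψ y * g (s⁻¹ • (x - y)) := by
    refine (hψ.norm.mul_const B).mono' (hψ.1.mul
      (hg.comp ((continuous_sub_left x).const_smul s⁻¹)).aestronglyMeasurable)
      (Eventually.of_forall fun y => ?_)
    rw [norm_mul]
    gcongr
    exact hB _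
  have h1 : conv (dil g s) ψ x =
      (s ^ Module.finrank ℝ E)⁻¹ * ∫ y, ψ y * g (s⁻¹ • (x - y)) := by
    rw [← integral_const_mul]
    refine integral_congr_ae (Eventually.of_forall fun y => ?_)
    simp only [dil, smul_eq_mul]
    ring
  rw [integral_const_mul, h1]
  congr 1
  simp_rw [taylorRem, mul_sub, ← smul_sub]
  rw [integral_sub hint' hint, hsum, sub_zero]

variable [FiniteDimensional ℝ E] [(volume : Measure E).IsAddHaarMeasure]

/-- Decay of `e^{tℒ}ψ` in a weighted `L¹` space for data with vanishing moments. -/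
theorem HasDecay.exists_lintegral_rpow_mul_conv_dil_le_of_moments {m : ℕ} {a ℓ K : ℝ} {g : E → ℝ}
    (hg : HasDecay (m + 1) a g) (hℓ : 0 ≤ ℓ) (h : Module.finrank ℝ E + ℓ < a) (hℓK : ℓ ≤ K)
    (hmK : m ≤ K) (hKm : K ≤ m + 1) :
    ∃ C : ℝ≥0∞, C ≠ ⊤ ∧ ∀ s : ℝ, 0 < s → ∀ ψ : E → ℝ, Integrable ψ →
      Integrable (fun y => ‖y‖ ^ K * ψ y) →
      (∀ k ≤ m, ∀ T : E [×k]→L[ℝ] ℝ, ∫ y, ψ y * T (fun _ => y) = 0) →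
      ∫⁻ x, ENNReal.ofReal (‖x‖ ^ ℓ) * ‖conv (dil g s) ψ x‖ₑ ≤
        C * ENNReal.ofReal (s ^ (ℓ - K)) * ∫⁻ y, ENNReal.ofReal (‖y‖ ^ K) * ‖ψ y‖ₑ := by
  have hD : (0 : ℝ) ≤ Module.finrank ℝ E := Nat.cast_nonneg _
  have ha : 0 ≤ a := by linarith
  obtain ⟨C, hC, hrem⟩ := hg.rpow_mul_norm_taylorRem_le ha hℓ hℓK hmK hKm
  obtain ⟨B, -, hB⟩ := hg.exists_norm_le ha (Nat.zero_le _)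
  simp only [norm_iteratedFDeriv_zero] at hB
  set H : E → ℝ≥0∞ := fun x => ENNReal.ofReal ((1 + ‖x‖) ^ (-(a - ℓ)))
  have hHm : Measurable H := ((measurable_norm.const_add 1).pow_const _).ennreal_ofReal
  have hH : ∫⁻ x, H x < ⊤ := finite_integral_one_add_norm (by linarith)
  refine ⟨ENNReal.ofReal C * (2 * ∫⁻ x, H x), ENNReal.mul_ne_top ENNReal.ofReal_ne_top
    (ENNReal.mul_ne_top (by simp) hH.ne), fun s hs ψ hψ hψK hψ0 => ?_⟩
  set c : E → ℝ≥0∞ := fun y => ENNReal.ofReal C *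
    ENNReal.ofReal (s ^ (ℓ - K) * (s ^ Module.finrank ℝ E)⁻¹) *
    (ENNReal.ofReal (‖y‖ ^ K) * ‖ψ y‖ₑ) with hc
  have hcm : AEMeasurable c :=
    ((measurable_norm.pow_const K).ennreal_ofReal.aemeasurable.mul hψ.1.enorm).const_mul _
  have hpt : ∀ x, ENNReal.ofReal (‖x‖ ^ ℓ) * ‖conv (dil g s) ψ x‖ₑ ≤
      ∫⁻ y, c y * (H (s⁻¹ • (x - y)) + H (s⁻¹ • x)) := by
    intro x
    rw [conv_dil_eq_integral_taylorRem hg.contDiff.continuous hB hmK hψ hψK hψ0]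
    refine (mul_le_mul_right (enorm_integral_le_lintegral_enorm _) _).trans ?_
    rw [← lintegral_const_mul' _ _ ENNReal.ofReal_ne_top]
    refine lintegral_mono fun y => ?_
    have h1 := hrem (s⁻¹ • x) (s⁻¹ • y)
    rw [← smul_sub] at h1
    simp only [hc, H]
    rw [← ofReal_norm, ← ofReal_norm, ← ENNReal.ofReal_add (by positivity) (by positivity),
      ← ENNReal.ofReal_mul (by positivity), ← ENNReal.ofReal_mul (by positivity),
      ← ENNReal.ofReal_mul (by positivity), ← ENNReal.ofReal_mul (by positivity),
      ← ENNReal.ofReal_mul (by positivity)]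
    apply ENNReal.ofReal_le_ofReal
    have hx : ‖x‖ ^ ℓ = s ^ ℓ * ‖s⁻¹ • x‖ ^ ℓ := by
      rw [norm_smul, norm_inv, Real.norm_of_nonneg hs.le, ← Real.mul_rpow (by positivity)
        (by positivity), mul_inv_cancel_left₀ hs.ne']
    have hy : ‖s⁻¹ • y‖ ^ K = s ^ (-K) * ‖y‖ ^ K := by
      rw [norm_smul, norm_inv, Real.norm_of_nonneg hs.le, Real.mul_rpow (by positivity)
        (by positivity), Real.inv_rpow hs.le, Real.rpow_neg hs.le]
    rw [hx, norm_mul, norm_mul, Real.norm_of_nonneg (by positivity), sub_eq_add_neg,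
      Real.rpow_add hs]
    rw [hy] at h1
    calc _ = s ^ ℓ * (s ^ Module.finrank ℝ E)⁻¹ * ‖ψ y‖ *
          (‖s⁻¹ • x‖ ^ ℓ * ‖taylorRem g m (s⁻¹ • x) (s⁻¹ • y)‖) := by ring
      _ ≤ s ^ ℓ * (s ^ Module.finrank ℝ E)⁻¹ * ‖ψ y‖ * _ :=
          mul_le_mul_of_nonneg_left h1 (by positivity)
      _ = _ := by ring
  refine (lintegral_mono hpt).trans ?_
  have hinner : ∀ y, ∫⁻ x, c y * (H (s⁻¹ • (x - y)) + H (s⁻¹ • x)) =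
      c y * (ENNReal.ofReal (s ^ Module.finrank ℝ E) * (2 * ∫⁻ x, H x)) := by
    intro y
    have hm1 : Measurable fun x : E => H (s⁻¹ • x) := hHm.comp (measurable_const_smul s⁻¹)
    have hm2 : Measurable fun x : E => H (s⁻¹ • (x - y)) := hm1.comp (measurable_sub_const y)
    rw [lintegral_const_mul _ (by exact hm2.add hm1), lintegral_add_right _ hm1,
      lintegral_sub_right_eq_self (fun x => H (s⁻¹ • x)) y, lintegral_comp_inv_smul hHm hs]
    ring
  rw [lintegral_lintegral_swap]
  · simp_rw [hinner]
    rw [lintegral_mul_const'' _ hcm]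
    simp only [hc]
    rw [lintegral_const_mul' _ _ (by finiteness)]
    refine le_of_eq ?_
    have hs2 : ENNReal.ofReal (s ^ (ℓ - K) * (s ^ Module.finrank ℝ E)⁻¹) *
        ENNReal.ofReal (s ^ Module.finrank ℝ E) = ENNReal.ofReal (s ^ (ℓ - K)) := by
      rw [← ENNReal.ofReal_mul (by positivity), inv_mul_cancel_right₀ (by positivity)]
    rw [← hs2]
    ring
  · refine AEMeasurable.mul hcm.comp_snd (Measurable.aemeasurable ?_)
    exact (hHm.comp ((measurable_fst.sub measurable_snd).const_smul s⁻¹)).add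
      (hHm.comp (measurable_fst.const_smul s⁻¹))

end Moments

section Weights

theorem lintegral_rpow_mul_enorm_le {E : Type*} [NormedAddCommGroup E] [MeasureSpace E]
    {ℓ K : ℝ} (hℓ : 0 ≤ ℓ) (hℓK : ℓ ≤ K) {ψ : E → ℝ} (hψ : Integrable ψ) :
    ∫⁻ y, ENNReal.ofReal (‖y‖ ^ ℓ) * ‖ψ y‖ₑ ≤
      (∫⁻ y, ‖ψ y‖ₑ) + ∫⁻ y, ENNReal.ofReal (‖y‖ ^ K) * ‖ψ y‖ₑ := by
  rw [← lintegral_add_left' hψ.1.enorm]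
  refine lintegral_mono fun y => ?_
  rw [← one_add_mul]
  gcongr
  rw [← ENNReal.ofReal_one, ← ENNReal.ofReal_add zero_le_one (by positivity)]
  apply ENNReal.ofReal_le_ofReal
  rcases le_total ‖y‖ 1 with h | h
  · exact (Real.rpow_le_one (norm_nonneg y) h hℓ).trans (le_add_of_nonneg_right (by positivity))
  · exact (Real.rpow_le_rpow_of_exponent_le h hℓK).trans (by linarith)

theorem two_rpow_neg_mul_one_add_rpow {t : ℝ} (ht : 0 < t) (p : ℝ) :
    2 ^ (-p) * (1 + t) ^ p = ((1 + t) / 2) ^ p := by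
  rw [Real.div_rpow (by positivity) (by norm_num), Real.rpow_neg (by norm_num)]
  field_simp

theorem one_add_half_rpow_le {t p : ℝ} (ht : 0 < t) (hp : p ≤ 0) :
    (1 + t / 2) ^ p ≤ 2 ^ (-p) * (1 + t) ^ p := by
  rw [two_rpow_neg_mul_one_add_rpow ht]
  exact Real.rpow_le_rpow_of_nonpos (by positivity) (by linarith) hp

theorem rpow_mul_half_rpow_neg {t d e : ℝ} (ht : 0 < t) :
    t ^ (e / d) * ((t / 2) ^ d⁻¹) ^ (-e) = 2 ^ (e / d) := by
  rw [← Real.rpow_mul (by positivity), Real.div_rpow ht.le (by norm_num),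
    show d⁻¹ * -e = -(e / d) by ring, Real.rpow_neg ht.le, Real.rpow_neg (by norm_num)]
  field_simp

end Weights

section Semigroup

variable {E : Type*} [NormedAddCommGroup E] [NormedSpace ℝ E] [MeasureSpace E] [BorelSpace E]
  [FiniteDimensional ℝ E] [(volume : Measure E).IsAddHaarMeasure]

theorem integrable_conv {f u : E → ℝ} (hf : Integrable f) (hu : Integrable u) :
    Integrable (conv f u) := by
  have := hu.integrable_convolution (ContinuousLinearMap.lsmul ℝ ℝ) hf
  exact this

theorem conv_assoc {f h u : E → ℝ} (hf : Continuous f) {B : ℝ} (hB : ∀ x, ‖f x‖ ≤ B)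
    (hh : Integrable h) (hu : Integrable u) : conv f (conv h u) = conv (conv f h) u := by
  ext x
  have hi : Integrable (fun p : E × E => u p.2 * h (p.1 - p.2)) (volume.prod volume) :=
    hu.convolution_integrand (ContinuousLinearMap.lsmul ℝ ℝ) hh
  have hi2 : Integrable (fun p : E × E => u p.2 * h (p.1 - p.2) * f (x - p.1))
      (volume.prod volume) := by
    refine hi.mul_bdd (c := B) ?_ (Eventually.of_forall fun p => hB _)
    exact (hf.comp (by fun_prop : Continuous fun p : E × E => x - p.1)).aestronglyMeasurable
  calc conv f (conv h u) x = ∫ y, ∫ z, u z * h (y - z) * f (x - y) := by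
        simp only [conv, smul_eq_mul, integral_mul_const]
    _ = ∫ z, ∫ y, u z * h (y - z) * f (x - y) := integral_integral_swap hi2
    _ = ∫ z, ∫ y, u z * h y * f (x - z - y) := by
        refine integral_congr_ae (Eventually.of_forall fun z => ?_)
        dsimp only
        rw [← integral_add_right_eq_self _ z]
        refine integral_congr_ae (Eventually.of_forall fun y => ?_)
        dsimp only
        rw [add_sub_cancel_right, sub_sub, add_comm z]
    _ = _ := by simp only [conv, smul_eq_mul, mul_assoc, integral_const_mul]

theorem HasDecay.exists_lintegral_rpow_mul_conv_le_one_add {m : ℕ} {a ℓ K d : ℝ} {g : E → ℝ}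
    (hg : HasDecay (m + 1) a g) (hd : 0 < d) (hℓ : 0 ≤ ℓ) (h : Module.finrank ℝ E + ℓ < a)
    (hℓK : ℓ ≤ K) (hmK : m ≤ K) (hKm : K ≤ m + 1) :
    ∃ C : ℝ≥0∞, C ≠ ⊤ ∧ ∀ t : ℝ, 0 < t → ∀ ψ : E → ℝ, Integrable ψ →
      Integrable (fun y => ‖y‖ ^ K * ψ y) →
      (∀ k ≤ m, ∀ T : E [×k]→L[ℝ] ℝ, ∫ y, ψ y * T (fun _ => y) = 0) →
      ∫⁻ x, ENNReal.ofReal (‖x‖ ^ ℓ) * ‖conv (dil g (t ^ d⁻¹)) ψ x‖ₑ ≤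
        C * ENNReal.ofReal ((1 + t) ^ ((ℓ - K) / d)) *
          ((∫⁻ y, ‖ψ y‖ₑ) + ∫⁻ y, ENNReal.ofReal (‖y‖ ^ K) * ‖ψ y‖ₑ) := by
  obtain ⟨C₁, hC₁, h₁⟩ := hg.exists_lintegral_rpow_mul_iteratedFDeriv_conv_dil_le hℓ h
    (Nat.zero_le _)
  obtain ⟨C₂, hC₂, h₂⟩ := hg.exists_lintegral_rpow_mul_conv_dil_le_of_moments hℓ h hℓK hmK hKm
  refine ⟨(2 * C₁ + C₂) * ENNReal.ofReal (2 ^ ((K - ℓ) / d)), by finiteness,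
    fun t ht ψ hψ hψK hψ0 => ?_⟩
  have hneg : (ℓ - K) / d ≤ 0 := div_nonpos_of_nonpos_of_nonneg (by linarith) hd.le
  have hhalf : 2 ^ ((K - ℓ) / d) * (1 + t) ^ ((ℓ - K) / d) = ((1 + t) / 2) ^ ((ℓ - K) / d) := by
    rw [← two_rpow_neg_mul_one_add_rpow ht, ← neg_div, neg_sub]
  set V := ∫⁻ y, ‖ψ y‖ₑ
  set VK := ∫⁻ y, ENNReal.ofReal (‖y‖ ^ K) * ‖ψ y‖ₑ
  rw [mul_assoc (2 * C₁ + C₂), ← ENNReal.ofReal_mul (by positivity), hhalf]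
  rcases le_total t 1 with h1 | h1
  · have e := h₁ (t ^ d⁻¹) (by positivity) ψ hψ
    simp only [← ofReal_norm, norm_iteratedFDeriv_zero] at e
    simp only [ofReal_norm] at e
    have hs1 : ENNReal.ofReal ((t ^ d⁻¹) ^ ℓ) ≤ 1 := by
      rw [ENNReal.ofReal_le_one]
      exact Real.rpow_le_one (by positivity) (Real.rpow_le_one ht.le h1 (by positivity)) hℓ
    have hb : 1 ≤ ENNReal.ofReal (((1 + t) / 2) ^ ((ℓ - K) / d)) := by
      rw [ENNReal.one_le_ofReal]
      exact Real.one_le_rpow_of_pos_of_le_one_of_nonpos (by positivity) (by linarith) hneg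
    calc _ ≤ _ := e
      _ ≤ C₁ * 1 * (1 * (V + VK) + (V + VK)) := by
          gcongr
          · simp
          · exact le_self_add
          · exact lintegral_rpow_mul_enorm_le hℓ hℓK hψ
      _ = 2 * C₁ * 1 * (V + VK) := by ring
      _ ≤ _ := by
          gcongr
          exact le_self_add
  · refine (h₂ (t ^ d⁻¹) (by positivity) ψ hψ hψK hψ0).trans ?_
    gcongr
    · exact le_add_self
    · rw [← Real.rpow_mul ht.le, inv_mul_eq_div]
      exact Real.rpow_le_rpow_of_nonpos (by positivity) (by linarith) hneg
    · exact le_add_self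

/-- The decay estimate for the evolution of data with vanishing moments. -/
theorem HasDecay.exists_decay_of_moments {n m : ℕ} {a ℓ K d : ℝ} {g : E → ℝ}
    (hg : HasDecay n a g) (hmn : m + 1 ≤ n) (hd : 0 < d) (hℓ : 0 ≤ ℓ)
    (h : Module.finrank ℝ E + ℓ < a) (hℓK : ℓ ≤ K) (hmK : m ≤ K) (hKm : K ≤ m + 1)
    (hsg : ∀ t s : ℝ, 0 < t → 0 < s →
      dil g ((t + s) ^ d⁻¹) = conv (dil g (t ^ d⁻¹)) (dil g (s ^ d⁻¹)))
    {j : ℕ} (hj : j ≤ n) {q : ℝ≥0∞} (hq : 1 ≤ q) :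
    ∃ C : ℝ≥0∞, C ≠ ⊤ ∧ ∀ t : ℝ, 0 < t → ∀ ψ : E → ℝ, Integrable ψ →
      Integrable (fun y => ‖y‖ ^ K * ψ y) →
      (∀ k ≤ m, ∀ T : E [×k]→L[ℝ] ℝ, ∫ y, ψ y * T (fun _ => y) = 0) →
      ENNReal.ofReal (t ^ ((Module.finrank ℝ E * (1 - q.toReal⁻¹) + j) / d)) *
          eLpNorm (iteratedFDeriv ℝ j (conv (dil g (t ^ d⁻¹)) ψ)) q +
        ENNReal.ofReal (t ^ ((j : ℝ) / d) * (1 + t) ^ (-ℓ / d)) *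
          ((∫⁻ x, ‖iteratedFDeriv ℝ j (conv (dil g (t ^ d⁻¹)) ψ) x‖ₑ) +
            ∫⁻ x, ENNReal.ofReal (‖x‖ ^ ℓ) *
              ‖iteratedFDeriv ℝ j (conv (dil g (t ^ d⁻¹)) ψ) x‖ₑ) ≤
        C * ENNReal.ofReal ((1 + t) ^ (-K / d)) *
          ((∫⁻ y, ‖ψ y‖ₑ) + ∫⁻ y, ENNReal.ofReal (‖y‖ ^ K) * ‖ψ y‖ₑ) := by
  have hD : (0 : ℝ) ≤ Module.finrank ℝ E := Nat.cast_nonneg _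
  have ha : 0 ≤ a := by linarith
  have hK : 0 ≤ K := hℓ.trans hℓK
  obtain ⟨C₁, hC₁, h₁⟩ := hg.exists_eLpNorm_iteratedFDeriv_conv_dil_le (by linarith) hj hq
  obtain ⟨C₂, hC₂, h₂⟩ := hg.exists_lintegral_rpow_mul_iteratedFDeriv_conv_dil_le le_rfl
    (by linarith) hj
  obtain ⟨C₃, hC₃, h₃⟩ := hg.exists_lintegral_rpow_mul_iteratedFDeriv_conv_dil_le hℓ h hj
  obtain ⟨C₄, hC₄, h₄⟩ := (hg.mono hmn).exists_lintegral_rpow_mul_conv_le_one_add hd le_rfl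
    (by linarith) hK hmK hKm
  obtain ⟨C₅, hC₅, h₅⟩ := (hg.mono hmn).exists_lintegral_rpow_mul_conv_le_one_add hd hℓ h hℓK
    hmK hKm
  set e := Module.finrank ℝ E * (1 - q.toReal⁻¹) + j with he
  set cK := ENNReal.ofReal (2 ^ (K / d))
  set cℓ := ENNReal.ofReal (2 ^ ((K - ℓ) / d))
  set cj := ENNReal.ofReal (2 ^ ((j : ℝ) / d))
  refine ⟨ENNReal.ofReal (2 ^ (e / d)) * C₁ * (C₄ * cK) + cj * C₂ * (2 * (C₄ * cK)) +
    cj * C₃ * (C₄ * cK + C₅ * cℓ), by finiteness, fun t ht ψ hψ hψK hψ0 => ?_⟩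
  set s := (t / 2) ^ d⁻¹
  have hs : 0 < s := by positivity
  have hs' := hg.dilation ha hs
  obtain ⟨B, -, hB⟩ := hs'.exists_norm_le ha (Nat.zero_le _)
  simp only [norm_iteratedFDeriv_zero] at hB
  set u := conv (dil g s) ψ
  have hu : Integrable u := integrable_conv (hs'.integrable (by linarith)) hψ
  have hv : conv (dil g (t ^ d⁻¹)) ψ = conv (dil g s) u := by
    rw [conv_assoc hs'.contDiff.continuous hB (hs'.integrable (by linarith)) hψ,
      ← hsg _ _ (by positivity) (by positivity), add_halves]
  rw [hv]
  set W := (∫⁻ y, ‖ψ y‖ₑ) + ∫⁻ y, ENNReal.ofReal (‖y‖ ^ K) * ‖ψ y‖ₑ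
  set τ := ENNReal.ofReal ((1 + t) ^ (-K / d))
  have hu0 : ∫⁻ y, ‖u y‖ₑ ≤ C₄ * cK * τ * W := by
    have := h₄ (t / 2) (by positivity) ψ hψ hψK hψ0
    simp only [Real.rpow_zero, ENNReal.ofReal_one, one_mul, zero_sub] at this
    refine this.trans ?_
    rw [mul_assoc C₄ cK, ← ENNReal.ofReal_mul (by positivity)]
    gcongr
    refine (one_add_half_rpow_le ht ?_).trans_eq ?_
    · exact div_nonpos_of_nonpos_of_nonneg (by linarith) hd.le
    · congr 2
      ring
  have huℓ : ENNReal.ofReal ((1 + t) ^ (-ℓ / d)) * ∫⁻ y, ENNReal.ofReal (‖y‖ ^ ℓ) * ‖u y‖ₑ ≤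
      C₅ * cℓ * τ * W := by
    refine (mul_le_mul_right (h₅ (t / 2) (by positivity) ψ hψ hψK hψ0) _).trans ?_
    have h6 : (1 + t) ^ (-ℓ / d) * (1 + t / 2) ^ ((ℓ - K) / d) ≤
        2 ^ ((K - ℓ) / d) * (1 + t) ^ (-K / d) := by
      have h7 := one_add_half_rpow_le (p := (ℓ - K) / d) ht
        (div_nonpos_of_nonpos_of_nonneg (by linarith) hd.le)
      calc _ ≤ (1 + t) ^ (-ℓ / d) * _ := mul_le_mul_of_nonneg_left h7 (by positivity)
        _ = 2 ^ (-((ℓ - K) / d)) * ((1 + t) ^ (-ℓ / d) * (1 + t) ^ ((ℓ - K) / d)) := by ring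
        _ = _ := by
          rw [← Real.rpow_add (by positivity)]
          congr 2 <;> ring
    have h8 := ENNReal.ofReal_le_ofReal h6
    rw [ENNReal.ofReal_mul (by positivity), ENNReal.ofReal_mul (by positivity)] at h8
    calc _ = C₅ * (ENNReal.ofReal ((1 + t) ^ (-ℓ / d)) *
          ENNReal.ofReal ((1 + t / 2) ^ ((ℓ - K) / d))) * W := by ring
      _ ≤ C₅ * (cℓ * τ) * W := by gcongr
      _ = _ := by ring
  have hpe : ENNReal.ofReal (t ^ (e / d)) * ENNReal.ofReal (s ^ (-e)) =
      ENNReal.ofReal (2 ^ (e / d)) := by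
    rw [← ENNReal.ofReal_mul (by positivity), rpow_mul_half_rpow_neg ht]
  have hpj : ENNReal.ofReal (t ^ ((j : ℝ) / d)) * ENNReal.ofReal (s ^ (-(j : ℝ))) = cj := by
    rw [← ENNReal.ofReal_mul (by positivity), rpow_mul_half_rpow_neg ht]
  have hpℓ : ENNReal.ofReal ((1 + t) ^ (-ℓ / d)) ≤ 1 := by
    rw [ENNReal.ofReal_le_one]
    exact Real.rpow_le_one_of_one_le_of_nonpos (by linarith)
      (div_nonpos_of_nonpos_of_nonneg (by linarith) hd.le)
  have hpℓs : ENNReal.ofReal ((1 + t) ^ (-ℓ / d)) * ENNReal.ofReal (s ^ ℓ) ≤ 1 := by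
    rw [← ENNReal.ofReal_mul (by positivity), ENNReal.ofReal_le_one, neg_div,
      Real.rpow_neg (by positivity), inv_mul_le_one₀ (by positivity), ← Real.rpow_mul (by positivity),
      inv_mul_eq_div]
    exact Real.rpow_le_rpow (by positivity) (by linarith) (by positivity)
  have e₁ := h₁ s hs u hu
  have e₂ := h₂ s hs u hu
  have e₃ := h₃ s hs u hu
  simp only [Real.rpow_zero, ENNReal.ofReal_one, one_mul] at e₂
  set U := ∫⁻ y, ‖u y‖ₑ
  set Uℓ := ∫⁻ y, ENNReal.ofReal (‖y‖ ^ ℓ) * ‖u y‖ₑ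
  rw [ENNReal.ofReal_mul (by positivity)]
  set p := ENNReal.ofReal ((1 + t) ^ (-ℓ / d))
  calc _ ≤ ENNReal.ofReal (t ^ (e / d)) * (C₁ * ENNReal.ofReal (s ^ (-e)) * U) +
        ENNReal.ofReal (t ^ ((j : ℝ) / d)) * p *
          (C₂ * ENNReal.ofReal (s ^ (-(j : ℝ))) * (U + U) +
            C₃ * ENNReal.ofReal (s ^ (-(j : ℝ))) * (ENNReal.ofReal (s ^ ℓ) * U + Uℓ)) := by gcongr
    _ = (ENNReal.ofReal (t ^ (e / d)) * ENNReal.ofReal (s ^ (-e))) * C₁ * U +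
        (ENNReal.ofReal (t ^ ((j : ℝ) / d)) * ENNReal.ofReal (s ^ (-(j : ℝ)))) *
          (C₂ * (2 * (p * U)) + C₃ * (p * ENNReal.ofReal (s ^ ℓ) * U + p * Uℓ)) := by ring
    _ ≤ ENNReal.ofReal (2 ^ (e / d)) * C₁ * (C₄ * cK * τ * W) +
        cj * (C₂ * (2 * (1 * (C₄ * cK * τ * W))) +
          C₃ * (1 * (C₄ * cK * τ * W) + C₅ * cℓ * τ * W)) := by
        rw [hpe, hpj]
        gcongr
    _ = _ := by ring

end Semigroup

section Mass

variable {E : Type*} [NormedAddCommGroup E] [NormedSpace ℝ E]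

theorem dil_one (g : E → ℝ) : dil g 1 = g := by
  ext x
  simp [dil]

variable [MeasureSpace E] [BorelSpace E] [FiniteDimensional ℝ E]
  [(volume : Measure E).IsAddHaarMeasure]

theorem integral_dil (g : E → ℝ) {s : ℝ} (hs : 0 < s) : ∫ x, dil g s x = ∫ x, g x := by
  simp only [dil]
  rw [integral_const_mul, Measure.integral_comp_inv_smul_of_nonneg _ _ hs.le, smul_eq_mul,
    inv_mul_cancel_left₀ (by positivity)]

theorem integral_conv {f u : E → ℝ} (hf : Integrable f) (hu : Integrable u) :
    ∫ x, conv f u x = (∫ x, u x) * ∫ x, f x :=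
  integral_convolution (ContinuousLinearMap.lsmul ℝ ℝ) hu hf

theorem HasDecay.integrable_norm_rpow_mul {n : ℕ} {a K : ℝ} {g : E → ℝ} (hg : HasDecay n a g)
    (hK : 0 ≤ K) (h : Module.finrank ℝ E + K < a) : Integrable fun y => ‖y‖ ^ K * g y := by
  refine ⟨((continuous_norm.rpow_const fun _ => Or.inr hK).mul
    hg.contDiff.continuous).aestronglyMeasurable, ?_⟩
  have := hg.lintegral_rpow_lt_top hK h (Nat.zero_le n)
  simp only [← ofReal_norm, norm_iteratedFDeriv_zero] at this
  refine lt_of_le_of_lt (lintegral_mono fun y => le_of_eq ?_) this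
  rw [← ofReal_norm, norm_mul, Real.norm_of_nonneg (by positivity),
    ENNReal.ofReal_mul (by positivity)]

/-- The mass of a self-similar semigroup kernel is one, unless the kernel vanishes. -/
theorem HasDecay.integral_eq_one_or_eq_zero {a d : ℝ} {g : E → ℝ} (hg : HasDecay 1 a g)
    (hd : 0 < d) (h : Module.finrank ℝ E < a)
    (hsg : ∀ t s : ℝ, 0 < t → 0 < s →
      dil g ((t + s) ^ d⁻¹) = conv (dil g (t ^ d⁻¹)) (dil g (s ^ d⁻¹))) :
    ∫ x, g x = 1 ∨ g = 0 := by
  have hD : (0 : ℝ) ≤ Module.finrank ℝ E := Nat.cast_nonneg _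
  have ha : 0 ≤ a := by linarith
  have hi := hg.integrable h
  have hmass : ∫ x, g x = (∫ x, g x) * ∫ x, g x := by
    have h1 := hsg 1 1 one_pos one_pos
    rw [Real.one_rpow, dil_one] at h1
    calc ∫ x, g x = ∫ x, dil g ((1 + 1) ^ d⁻¹) x := (integral_dil g (by positivity)).symm
      _ = _ := by rw [h1, integral_conv hi hi]
  rcases eq_or_ne (∫ x, g x) 0 with h0 | h0
  swap
  · exact Or.inl (mul_left_cancel₀ h0 (by linarith))
  right
  set θ := min 1 ((a - Module.finrank ℝ E) / 2)
  have hθ : 0 < θ := lt_min one_pos (by linarith)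
  have hθ1 : θ ≤ 1 := min_le_left _ _
  have hθa : θ ≤ (a - Module.finrank ℝ E) / 2 := min_le_right _ _
  have hgθ := hg.integrable_norm_rpow_mul hθ.le (by linarith)
  obtain ⟨C, hC, hb⟩ := HasDecay.exists_lintegral_rpow_mul_conv_dil_le_of_moments (m := 0)
    (K := θ) hg le_rfl (by linarith) hθ.le (by simpa using hθ.le) (by simpa using hθ1)
  have hmom : ∀ k ≤ 0, ∀ T : E [×k]→L[ℝ] ℝ, ∫ y, g y * T (fun _ => y) = 0 := by
    intro k hk T
    obtain rfl : k = 0 := by omega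
    have : ∀ y : E, T (fun _ => y) = T 0 := fun y => congrArg T (Subsingleton.elim _ _)
    simp_rw [this]
    rw [integral_mul_const, h0, zero_mul]
  have hle : ∀ s : ℝ, 0 < s → ∫⁻ x, ‖g x‖ₑ ≤
      C * ENNReal.ofReal (s ^ (-θ)) * ∫⁻ y, ENNReal.ofReal (‖y‖ ^ θ) * ‖g y‖ₑ := by
    intro s hs
    have h1 := hsg (s ^ d) 1 (by positivity) one_pos
    rw [Real.one_rpow, dil_one, Real.rpow_rpow_inv hs.le hd.ne'] at h1
    have h2 := hb s hs g hi hgθ hmom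
    have h3 := lintegral_rpow_mul_iteratedFDeriv_dil (s := (s ^ d + 1) ^ d⁻¹) hg.contDiff
      (by positivity) (Nat.zero_le _) 0
    simp only [← ofReal_norm, norm_iteratedFDeriv_zero] at h3
    simp only [ofReal_norm, Real.rpow_zero, ENNReal.ofReal_one, one_mul, Nat.cast_zero, sub_zero]
      at h3
    rw [← h1] at h2
    simp only [Real.rpow_zero, ENNReal.ofReal_one, one_mul, zero_sub, h3] at h2
    exact h2
  have hfin : ∫⁻ y, ENNReal.ofReal (‖y‖ ^ θ) * ‖g y‖ₑ ≠ ⊤ := by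
    have := hg.lintegral_rpow_lt_top hθ.le (by linarith) (Nat.zero_le _)
    simp only [← ofReal_norm, norm_iteratedFDeriv_zero] at this
    simpa only [ofReal_norm] using this.ne
  have hlim : Tendsto (fun s : ℝ => C * ENNReal.ofReal (s ^ (-θ)) *
      ∫⁻ y, ENNReal.ofReal (‖y‖ ^ θ) * ‖g y‖ₑ) atTop (𝓝 0) := by
    have h1 : Tendsto (fun s : ℝ => ENNReal.ofReal (s ^ (-θ))) atTop (𝓝 0) := by
      simpa using ENNReal.tendsto_ofReal (tendsto_rpow_neg_atTop hθ)
    have h2 := ENNReal.Tendsto.mul_const (ENNReal.Tendsto.const_mul h1 (Or.inr hC))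
      (Or.inr hfin)
    simpa using h2
  have hzero : ∫⁻ x, ‖g x‖ₑ = 0 := by
    refine le_antisymm (ge_of_tendsto hlim ?_) zero_le
    filter_upwards [eventually_gt_atTop 0] with s hs using hle s hs
  rw [lintegral_eq_zero_iff' hi.1.enorm] at hzero
  refine (hg.contDiff.continuous.ae_eq_iff_eq volume continuous_zero).1 ?_
  filter_upwards [hzero] with x hx
  simpa using hx

end Mass

section Derivatives

variable {N : ℕ}

theorem HasDecay.pderivE {n : ℕ} {a : ℝ} {f : EuclideanSpace ℝ (Fin N) → ℝ}
    (hf : HasDecay (n + 1) a f) (i : Fin N) : HasDecay n a (pderivE N i f) := by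
  have hc : ContDiff ℝ n (fderiv ℝ f) := hf.contDiff.fderiv_right (by norm_cast)
  refine ⟨hc.clm_apply contDiff_const, fun k hk => ?_⟩
  obtain ⟨C, hC, hb⟩ := hf.bound (k + 1) (by omega)
  refine ⟨C, hC, fun x => le_trans ?_ (hb x)⟩
  have h1 := norm_iteratedFDeriv_clm_apply_const (c := EuclideanSpace.single i (1 : ℝ))
    (hc.contDiffAt (x := x)) (n := k) (by exact_mod_cast hk)
  rw [PiLp.norm_single, norm_one, one_mul, norm_iteratedFDeriv_fderiv] at h1
  exact h1

theorem pderivE_conv {a : ℝ} {f u : EuclideanSpace ℝ (Fin N) → ℝ} (hf : HasDecay 1 a f)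
    (ha : 0 ≤ a) (hu : Integrable u) (i : Fin N) :
    pderivE N i (conv f u) = conv (pderivE N i f) u := by
  obtain ⟨C, -, hC⟩ := hf.exists_norm_le ha (Nat.zero_le _)
  obtain ⟨C', -, hC'⟩ := hf.exists_norm_le ha le_rfl
  simp only [norm_iteratedFDeriv_zero] at hC
  simp only [norm_iteratedFDeriv_one] at hC'
  have hf1 : ContDiff ℝ 1 f := hf.contDiff
  ext x
  rw [pderivE, (hasFDerivAt_conv hf1 hC hC' hu x).fderiv, conv,
    ContinuousLinearMap.integral_apply
      (integrable_smul_comp_sub (hf1.continuous_fderiv one_ne_zero) hC' hu x)]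
  rfl

/-- Iterated partial derivative along a list of coordinate directions. -/
noncomputable def pderivList (l : List (Fin N)) (f : EuclideanSpace ℝ (Fin N) → ℝ) :
    EuclideanSpace ℝ (Fin N) → ℝ :=
  l.foldr (_root_.pderivE N) f

theorem HasDecay.pderivList {a : ℝ} {f : EuclideanSpace ℝ (Fin N) → ℝ} (l : List (Fin N))
    {n : ℕ} (hf : HasDecay (n + l.length) a f) : HasDecay n a (pderivList l f) := by
  induction l generalizing n with
  | nil => exact hf
  | cons i l ih =>
    exact (ih (n := n + 1) (hf.mono (by simp only [List.length_cons]; omega))).pderivE i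

theorem pderivList_conv {a : ℝ} {f u : EuclideanSpace ℝ (Fin N) → ℝ} (l : List (Fin N))
    (hf : HasDecay l.length a f) (ha : 0 ≤ a) (hu : Integrable u) :
    pderivList l (conv f u) = conv (pderivList l f) u := by
  induction l with
  | nil => rfl
  | cons i l ih =>
    have h1 : pderivList l (conv f u) = conv (pderivList l f) u :=
      ih (hf.mono (by simp))
    have h2 : HasDecay 1 a (pderivList l f) :=
      HasDecay.pderivList l (hf.mono (by simp only [List.length_cons]; omega))
    change pderivE N i (pderivList l (conv f u)) = _
    rw [h1, pderivE_conv h2 ha hu]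
    rfl

/-- The list of coordinate directions, each repeated according to the multi-index. -/
def idxList (α : Fin N → ℕ) : List (Fin N) :=
  (List.ofFn fun i => List.replicate (α i) i).flatten

theorem length_idxList (α : Fin N → ℕ) : (idxList α).length = ∑ i, α i := by
  simp [idxList, List.length_flatten, List.map_ofFn, Function.comp_def, List.sum_ofFn]

theorem count_idxList (α : Fin N → ℕ) (j : Fin N) : (idxList α).count j = α j := by
  simp [idxList, List.count_flatten, List.map_ofFn, Function.comp_def, List.sum_ofFn,
    List.count_replicate]

theorem mderivE_eq_pderivList (α : Fin N → ℕ) (f : EuclideanSpace ℝ (Fin N) → ℝ) :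
    mderivE N α f = pderivList (idxList α) f := by
  have hrep : ∀ (n : ℕ) (i : Fin N) (h : EuclideanSpace ℝ (Fin N) → ℝ),
      (List.replicate n i).foldr (pderivE N) h = (pderivE N i)^[n] h := by
    intro n i h
    induction n with
    | zero => rfl
    | succ n ih => rw [List.replicate_succ, List.foldr_cons, ih, Function.iterate_succ_apply']
  rw [mderivE, pderivList, idxList, List.ofFn_eq_map, List.ofFn_eq_map]
  induction List.finRange N with
  | nil => rfl
  | cons i l ih => simp [ih, hrep]

theorem HasDecay.mderivE {a : ℝ} {f : EuclideanSpace ℝ (Fin N) → ℝ} (α : Fin N → ℕ)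
    {n : ℕ} (hf : HasDecay (n + ∑ i, α i) a f) : HasDecay n a (mderivE N α f) := by
  rw [mderivE_eq_pderivList]
  exact HasDecay.pderivList _ (by rwa [length_idxList])

theorem mderivE_conv {a : ℝ} {f u : EuclideanSpace ℝ (Fin N) → ℝ} (α : Fin N → ℕ)
    (hf : HasDecay (∑ i, α i) a f) (ha : 0 ≤ a) (hu : Integrable u) :
    mderivE N α (conv f u) = conv (mderivE N α f) u := by
  rw [mderivE_eq_pderivList, mderivE_eq_pderivList,
    pderivList_conv _ (by rwa [length_idxList]) ha hu]

end Derivatives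

section Moments

variable {N : ℕ}

theorem abs_mpowE_le (α : Fin N → ℕ) (x : EuclideanSpace ℝ (Fin N)) :
    |mpowE N α x| ≤ ‖x‖ ^ ∑ i, α i := by
  rw [mpowE, Finset.abs_prod, ← Finset.prod_pow_eq_pow_sum]
  refine Finset.prod_le_prod (fun i _ => abs_nonneg _) fun i _ => ?_
  rw [abs_pow]
  exact pow_le_pow_left₀ (abs_nonneg _) (PiLp.norm_apply_le x i) _

theorem contDiff_mpowE (α : Fin N → ℕ) : ContDiff ℝ 1 (mpowE N α) := by
  unfold mpowE
  fun_prop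

theorem pderivE_mpowE (α : Fin N → ℕ) (i : Fin N) (x : EuclideanSpace ℝ (Fin N)) :
    pderivE N i (mpowE N α) x = α i * mpowE N (Function.update α i (α i - 1)) x := by
  rw [pderivE, ← ((contDiff_mpowE α).differentiable one_ne_zero x).lineDeriv_eq_fderiv, lineDeriv]
  have h : ∀ t : ℝ, mpowE N α (x + t • EuclideanSpace.single i 1) =
      (x i + t) ^ α i * ∏ j ∈ Finset.univ.erase i, x j ^ α j := by
    intro t
    rw [mpowE, ← Finset.mul_prod_erase _ _ (Finset.mem_univ i)]
    congr 1
    · simp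
    · refine Finset.prod_congr rfl fun j hj => ?_
      simp [Finset.ne_of_mem_erase hj]
  have h2 : mpowE N (Function.update α i (α i - 1)) x =
      x i ^ (α i - 1) * ∏ j ∈ Finset.univ.erase i, x j ^ α j := by
    rw [mpowE, ← Finset.mul_prod_erase _ _ (Finset.mem_univ i)]
    congr 1
    · simp
    · refine Finset.prod_congr rfl fun j hj => ?_
      simp [Finset.ne_of_mem_erase hj]
  simp_rw [h]
  rw [h2]
  have h3 : HasDerivAt (fun t : ℝ => (x i + t) ^ α i) (α i * (x i + 0) ^ (α i - 1) * 1) 0 :=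
    ((hasDerivAt_id (0 : ℝ)).const_add (x i)).pow (α i)
  rw [(h3.mul_const _).deriv]
  ring

theorem HasDecay.integrable_mpowE_mul {n : ℕ} {a : ℝ} {f : EuclideanSpace ℝ (Fin N) → ℝ}
    (hf : HasDecay n a f) {α : Fin N → ℕ} (h : N + ((∑ i, α i : ℕ) : ℝ) < a) :
    Integrable fun x => mpowE N α x * f x := by
  have h1 := hf.integrable_norm_rpow_mul (K := ((∑ i, α i : ℕ) : ℝ)) (by positivity)
    (by simpa using h)
  refine h1.mono ((contDiff_mpowE α).continuous.mul hf.contDiff.continuous).aestronglyMeasurable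
    (Eventually.of_forall fun x => ?_)
  rw [norm_mul, norm_mul, Real.rpow_natCast, norm_pow, norm_norm]
  gcongr
  exact abs_mpowE_le α x

theorem sum_update_pred_le (α : Fin N → ℕ) (i : Fin N) :
    ∑ j, Function.update α i (α i - 1) j ≤ ∑ j, α j := by
  refine Finset.sum_le_sum fun j _ => ?_
  by_cases hj : j = i
  · subst hj
    simp
  · simp [hj]

theorem HasDecay.integral_mpowE_mul_pderivE {a : ℝ} {f : EuclideanSpace ℝ (Fin N) → ℝ}
    (hf : HasDecay 1 a f) {α : Fin N → ℕ} (h : N + ((∑ i, α i : ℕ) : ℝ) < a) (i : Fin N) :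
    ∫ x, mpowE N α x * _root_.pderivE N i f x =
      -(α i * ∫ x, mpowE N (Function.update α i (α i - 1)) x * f x) := by
  have h1 : N + ((∑ j, Function.update α i (α i - 1) j : ℕ) : ℝ) < a := by
    have : ((∑ j, Function.update α i (α i - 1) j : ℕ) : ℝ) ≤ ((∑ i, α i : ℕ) : ℝ) :=
      Nat.cast_le.2 (sum_update_pred_le α i)
    linarith
  have e := pderivE_mpowE α i
  rw [← integral_const_mul]
  simp_rw [← mul_assoc, ← e]
  refine integral_mul_fderiv_eq_neg_fderiv_mul_of_integrable
    (f := mpowE N α) (v := EuclideanSpace.single i 1) ?_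
    ((hf.pderivE i).integrable_mpowE_mul h) (hf.integrable_mpowE_mul h)
    (fun x _ => (contDiff_mpowE α).differentiable one_ne_zero x)
    (fun x _ => hf.contDiff.differentiable one_ne_zero x)
  have := (hf.integrable_mpowE_mul h1).const_mul (α i : ℝ)
  simp_rw [← mul_assoc, ← e] at this
  exact this

theorem HasDecay.integral_mpowE_mul_pderivList_eq_zero {a : ℝ}
    {f : EuclideanSpace ℝ (Fin N) → ℝ} (l : List (Fin N)) (hf : HasDecay l.length a f)
    {α : Fin N → ℕ} (h : N + ((∑ i, α i : ℕ) : ℝ) < a) (hα : ∃ i, α i < l.count i) :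
    ∫ x, mpowE N α x * SelfSimilar.pderivList l f x = 0 := by
  induction l generalizing α with
  | nil => simp at hα
  | cons i l ih =>
    have h2 : HasDecay 1 a (SelfSimilar.pderivList l f) :=
      HasDecay.pderivList l (hf.mono (by simp only [List.length_cons]; omega))
    refine (h2.integral_mpowE_mul_pderivE h i).trans ?_
    rcases Nat.eq_zero_or_pos (α i) with h0 | h0
    · simp [h0]
    rw [ih (hf.mono (by simp)) ?_ ?_, mul_zero, neg_zero]
    · have : ((∑ j, Function.update α i (α i - 1) j : ℕ) : ℝ) ≤ ((∑ i, α i : ℕ) : ℝ) :=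
        Nat.cast_le.2 (sum_update_pred_le α i)
      linarith
    · obtain ⟨k, hk⟩ := hα
      refine ⟨k, ?_⟩
      by_cases hki : k = i
      · subst hki
        rw [List.count_cons_self] at hk
        rw [Function.update_self]
        omega
      · rw [List.count_cons_of_ne (Ne.symm hki)] at hk
        rwa [Function.update_of_ne hki]

theorem HasDecay.integral_mpowE_mul_pderivList_self {a : ℝ}
    {f : EuclideanSpace ℝ (Fin N) → ℝ} (l : List (Fin N)) (hf : HasDecay l.length a f)
    {α : Fin N → ℕ} (h : N + ((∑ i, α i : ℕ) : ℝ) < a) (hα : ∀ i, α i = l.count i) :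
    ∫ x, mpowE N α x * SelfSimilar.pderivList l f x =
      (-1) ^ l.length * mfactE N α * ∫ x, f x := by
  induction l generalizing α with
  | nil =>
    have h0 : α = 0 := funext fun i => by simpa using hα i
    simp [h0, mpowE, mfactE, SelfSimilar.pderivList]
  | cons i l ih =>
    have h2 : HasDecay 1 a (SelfSimilar.pderivList l f) :=
      HasDecay.pderivList l (hf.mono (by simp only [List.length_cons]; omega))
    refine (h2.integral_mpowE_mul_pderivE h i).trans ?_
    have hi := hα i
    rw [List.count_cons_self] at hi
    rw [ih (hf.mono (by simp)) ?_ ?_]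
    · have hfact : mfactE N α = α i * mfactE N (Function.update α i (α i - 1)) := by
        rw [mfactE, mfactE, ← Finset.mul_prod_erase _ _ (Finset.mem_univ i),
          ← Finset.mul_prod_erase _ (fun j => (Function.update α i (α i - 1) j).factorial)
            (Finset.mem_univ i), ← mul_assoc, Function.update_self, Nat.mul_factorial_pred
            (by omega)]
        congr 1
        refine Finset.prod_congr rfl fun j hj => ?_
        rw [Function.update_of_ne (Finset.ne_of_mem_erase hj)]
      rw [hfact, List.length_cons, pow_succ]
      push_cast
      ring
    · have : ((∑ j, Function.update α i (α i - 1) j : ℕ) : ℝ) ≤ ((∑ i, α i : ℕ) : ℝ) :=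
        Nat.cast_le.2 (sum_update_pred_le α i)
      linarith
    · intro k
      by_cases hki : k = i
      · subst hki
        rw [Function.update_self]
        omega
      · rw [Function.update_of_ne hki, hα k, List.count_cons_of_ne (Ne.symm hki)]

end Moments

section ConvLinear

variable {E F : Type*} [NormedAddCommGroup E] [NormedSpace ℝ E] [NormedAddCommGroup F]
  [NormedSpace ℝ F] [MeasureSpace E] [BorelSpace E] [FiniteDimensional ℝ E]

theorem continuous_conv {f : E → F} (hf : Continuous f) {C : ℝ} (hC : ∀ x, ‖f x‖ ≤ C)
    {u : E → ℝ} (hu : Integrable u) : Continuous (conv f u) := by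
  refine continuous_of_dominated (bound := fun y => ‖u y‖ * C)
    (fun x => (integrable_smul_comp_sub hf hC hu x).1)
    (fun x => Eventually.of_forall fun y => ?_) (hu.norm.mul_const C)
    (Eventually.of_forall fun y => by fun_prop)
  rw [norm_smul]
  gcongr
  exact hC _

theorem conv_sub_sum {ι : Type*} (S : Finset ι) {f : E → ℝ} (hf : Continuous f) {C : ℝ}
    (hC : ∀ x, ‖f x‖ ≤ C) {u : E → ℝ} (hu : Integrable u) (c : ι → ℝ) {h : ι → E → ℝ}
    (hh : ∀ i ∈ S, Integrable (h i)) (x : E) :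
    conv f (fun y => u y - ∑ i ∈ S, c i * h i y) x =
      conv f u x - ∑ i ∈ S, c i * conv f (h i) x := by
  have hi : ∀ i ∈ S, Integrable fun y => c i * (h i y * f (x - y)) := fun i hi =>
    (integrable_smul_comp_sub hf hC (hh i hi) x).const_mul (c i)
  simp only [conv, smul_eq_mul, sub_mul, Finset.sum_mul, mul_assoc]
  have hu' : Integrable fun y => u y * f (x - y) := integrable_smul_comp_sub hf hC hu x
  rw [integral_sub hu' (integrable_finsetSum S hi), integral_finsetSum S hi]
  simp only [integral_const_mul]

theorem conv_comm [(volume : Measure E).IsAddHaarMeasure] (f u : E → ℝ) :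
    conv f u = conv u f := by
  ext x
  simp only [conv, smul_eq_mul]
  rw [← integral_sub_left_eq_self _ _ x]
  simp [mul_comm]

end ConvLinear

section Kernel

variable {N γ : ℕ} {d L : ℝ} {G : EuclideanSpace ℝ (Fin N) → ℝ → ℝ}

theorem hasDecay_kernel (hG : CondG N G γ d L) : HasDecay γ (N + L) (fun y => G y 1) := by
  refine ⟨?_, fun k hk => ?_⟩
  · rw [← contDiffOn_univ]
    exact hG.smooth.comp (contDiff_id.prodMk contDiff_const).contDiffOn
      fun x _ => zero_lt_one (α := ℝ)
  · obtain ⟨C, hC⟩ := hG.decay k hk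
    refine ⟨C, le_trans (by positivity) (hC 0), fun x => ?_⟩
    rw [Real.rpow_neg (by positivity), ← div_eq_mul_inv, le_div_iff₀ (by positivity), mul_comm]
    refine le_trans ?_ (hC x)
    refine mul_le_mul_of_nonneg_right (Real.rpow_le_rpow_of_exponent_le ?_ ?_) (norm_nonneg _)
    · simp
    · simp

theorem kernel_eq_dil (hG : CondG N G γ d L) {t : ℝ} (ht : 0 < t) :
    (fun x => G x t) = dil (fun y => G y 1) (t ^ d⁻¹) := by
  ext x
  rw [hG.scaling x t ht, dil, finrank_euclideanSpace_fin, ← Real.rpow_natCast,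
    ← Real.rpow_mul ht.le, ← Real.rpow_neg ht.le, ← Real.rpow_neg ht.le]
  congr 2
  · ring
  · congr 2
    ring

theorem kernel_add (hG : CondG N G γ d L) {t s : ℝ} (ht : 0 < t) (hs : 0 < s) :
    (fun x => G x (t + s)) = conv (fun x => G x t) (fun x => G x s) := by
  ext x
  rw [hG.semigroup x (t + s) s hs (by linarith), conv]
  simp [mul_comm]

theorem dil_kernel_add (hG : CondG N G γ d L) {t s : ℝ} (ht : 0 < t) (hs : 0 < s) :
    dil (fun y => G y 1) ((t + s) ^ d⁻¹) =
      conv (dil (fun y => G y 1) (t ^ d⁻¹)) (dil (fun y => G y 1) (s ^ d⁻¹)) := by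
  rw [← kernel_eq_dil hG ht, ← kernel_eq_dil hG hs, ← kernel_add hG ht hs,
    kernel_eq_dil hG (add_pos ht hs)]

theorem hasDecay_kernel_of_pos (hG : CondG N G γ d L) (hL : 0 < L) {t : ℝ} (ht : 0 < t) :
    HasDecay γ (N + L) (fun y => G y t) := by
  rw [kernel_eq_dil hG ht]
  exact (hasDecay_kernel hG).dilation (by positivity) (by positivity)

theorem sgOp_eq_conv (t : ℝ) (φ : EuclideanSpace ℝ (Fin N) → ℝ) :
    sgOp N G t φ = conv (fun x => G x t) φ := by
  ext x
  simp [sgOp, conv, mul_comm]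

theorem hasDecay_gA (hG : CondG N G γ d L) {α : Fin N → ℕ} {n : ℕ} (hα : n + ∑ i, α i ≤ γ) :
    HasDecay n (N + L) (mderivE N α fun y => G y 1) :=
  HasDecay.mderivE α ((hasDecay_kernel hG).mono hα)

theorem integrable_gA (hG : CondG N G γ d L) (hL : 0 < L) {α : Fin N → ℕ}
    (hα : ∑ i, α i ≤ γ) : Integrable fun y => gA N G α y 0 := by
  have h := (hasDecay_gA (n := 0) hG (by simpa using hα)).integrable (by simpa using hL)
  simpa [gA] using h.const_mul ((-1 : ℝ) ^ (∑ i, α i) / (mfactE N α : ℝ))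

theorem gA_eq_conv (hG : CondG N G γ d L) (hL : 0 < L) {α : Fin N → ℕ}
    (hα : ∑ i, α i ≤ γ) {t : ℝ} (ht : 0 < t) (x : EuclideanSpace ℝ (Fin N)) :
    gA N G α x t = conv (fun y => G y t) (fun y => gA N G α y 0) x := by
  have hi : Integrable fun y => G y t :=
    (hasDecay_kernel_of_pos hG hL ht).integrable (by simpa using hL)
  have h1 : mderivE N α (fun y => G y (t + 1)) =
      conv (fun y => G y t) (mderivE N α fun y => G y 1) := by
    rw [add_comm t 1, kernel_add hG one_pos ht,
      mderivE_conv α ((hasDecay_kernel hG).mono hα) (by positivity) hi, conv_comm]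
  rw [gA, h1]
  simp only [gA, conv, smul_eq_mul, zero_add, mul_assoc]
  rw [integral_const_mul]

theorem sgOp_sub_sum_eq_conv (hG : CondG N G γ d L) (hL : 0 < L) {m : ℕ} (hm : m ≤ γ)
    {φ : EuclideanSpace ℝ (Fin N) → ℝ} (hφ : Integrable φ) (c : (Fin N → ℕ) → ℝ)
    {t : ℝ} (ht : 0 < t) :
    (fun x => sgOp N G t φ x - ∑ α ∈ multiIdx N m, c α * gA N G α x t) =
      conv (dil (fun y => G y 1) (t ^ d⁻¹))
        (fun y => φ y - ∑ α ∈ multiIdx N m, c α * gA N G α y 0) := by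
  have hdec := hasDecay_kernel_of_pos hG hL ht
  obtain ⟨B, -, hB⟩ := hdec.exists_norm_le (by positivity) (Nat.zero_le _)
  simp only [norm_iteratedFDeriv_zero] at hB
  have hα : ∀ α ∈ multiIdx N m, ∑ i, α i ≤ γ := fun α h =>
    (Finset.mem_filter.1 h).2.trans hm
  ext x
  rw [← kernel_eq_dil hG ht, conv_sub_sum _ hdec.contDiff.continuous hB hφ c
    (fun α h => integrable_gA hG hL (hα α h)), sgOp_eq_conv]
  congr 1
  exact Finset.sum_congr rfl fun α h => by rw [gA_eq_conv hG hL (hα α h) ht]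

end Kernel

section WeightedNorm

variable {N : ℕ} {K : ℝ}

theorem wnorm_eq_lintegral_mul {F : Type*} [NormedAddCommGroup F] (k : ℝ)
    (φ : EuclideanSpace ℝ (Fin N) → F) :
    wnorm N k φ = ∫⁻ x, ENNReal.ofReal (1 + ‖x‖ ^ k) * ‖φ x‖ₑ := by
  refine lintegral_congr fun x => ?_
  rw [ENNReal.ofReal_mul (by positivity), ofReal_norm]

theorem wnorm_eq_add {F : Type*} [NormedAddCommGroup F] (k : ℝ)
    {φ : EuclideanSpace ℝ (Fin N) → F} (hφ : AEStronglyMeasurable φ) :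
    wnorm N k φ = (∫⁻ x, ‖φ x‖ₑ) + ∫⁻ x, ENNReal.ofReal (‖x‖ ^ k) * ‖φ x‖ₑ := by
  rw [wnorm_eq_lintegral_mul, ← lintegral_add_left' hφ.enorm]
  refine lintegral_congr fun x => ?_
  rw [ENNReal.ofReal_add zero_le_one (by positivity), ENNReal.ofReal_one, add_mul, one_mul]

theorem lintegral_rpow_mul_enorm_eq (k : ℝ) (φ : EuclideanSpace ℝ (Fin N) → ℝ) :
    ∫⁻ x, ‖‖x‖ ^ k * φ x‖ₑ = ∫⁻ x, ENNReal.ofReal (‖x‖ ^ k) * ‖φ x‖ₑ := by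
  refine lintegral_congr fun x => ?_
  rw [enorm_mul, Real.enorm_of_nonneg (by positivity)]

theorem integrable_of_memL1k {φ : EuclideanSpace ℝ (Fin N) → ℝ} (hφ : MemL1k N K φ) :
    Integrable φ := by
  refine ⟨hφ.1, lt_of_le_of_lt ?_ hφ.2⟩
  rw [wnorm_eq_add K hφ.1]
  exact le_self_add

theorem integrable_rpow_mul_of_memL1k (hK : 0 ≤ K) {φ : EuclideanSpace ℝ (Fin N) → ℝ}
    (hφ : MemL1k N K φ) : Integrable fun x => ‖x‖ ^ K * φ x := by
  refine ⟨(continuous_norm.rpow_const fun _ => Or.inr hK).aestronglyMeasurable.mul hφ.1,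
    lt_of_le_of_lt ?_ hφ.2⟩
  rw [wnorm_eq_add K hφ.1, ← lintegral_rpow_mul_enorm_eq]
  exact le_add_self

theorem wnorm_lt_top {φ : EuclideanSpace ℝ (Fin N) → ℝ} (hφ : Integrable φ)
    (hφK : Integrable fun x => ‖x‖ ^ K * φ x) : wnorm N K φ < ⊤ := by
  rw [wnorm_eq_add K hφ.1, ← lintegral_rpow_mul_enorm_eq]
  exact ENNReal.add_lt_top.2 ⟨hφ.2, hφK.2⟩

theorem wnorm_sub_sum_le {ι : Type*} (S : Finset ι) {φ : EuclideanSpace ℝ (Fin N) → ℝ}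
    (hφ : AEStronglyMeasurable φ) (c : ι → ℝ) {h : ι → EuclideanSpace ℝ (Fin N) → ℝ}
    (hh : ∀ i ∈ S, AEStronglyMeasurable (h i)) :
    wnorm N K (fun x => φ x - ∑ i ∈ S, c i * h i x) ≤
      wnorm N K φ + ∑ i ∈ S, ‖c i‖ₑ * wnorm N K (h i) := by
  simp only [wnorm_eq_lintegral_mul]
  have hw : Measurable fun x : EuclideanSpace ℝ (Fin N) => ENNReal.ofReal (1 + ‖x‖ ^ K) := by
    fun_prop
  have hφ' : AEMeasurable fun x => ENNReal.ofReal (1 + ‖x‖ ^ K) * ‖φ x‖ₑ :=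
    hw.aemeasurable.mul hφ.enorm
  have hm : ∀ i ∈ S, AEMeasurable fun x => ENNReal.ofReal (1 + ‖x‖ ^ K) * ‖h i x‖ₑ :=
    fun i hi => hw.aemeasurable.mul (hh i hi).enorm
  rw [← Finset.sum_congr rfl fun i hi => lintegral_const_mul'' ‖c i‖ₑ (hm i hi),
    ← lintegral_finsetSum' S fun i hi => (hm i hi).const_mul ‖c i‖ₑ,
    ← lintegral_add_left' hφ']
  refine lintegral_mono fun x => ?_
  calc _ ≤ ENNReal.ofReal (1 + ‖x‖ ^ K) * (‖φ x‖ₑ + ∑ i ∈ S, ‖c i‖ₑ * ‖h i x‖ₑ) := by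
        gcongr
        refine enorm_sub_le.trans ?_
        gcongr
        refine (enorm_sum_le _ _).trans_eq ?_
        simp only [enorm_mul]
    _ = _ := by
        rw [mul_add, Finset.mul_sum]
        simp only [mul_left_comm]

theorem enorm_momE_le {α : Fin N → ℕ} (hα : ((∑ i, α i : ℕ) : ℝ) ≤ K)
    (φ : EuclideanSpace ℝ (Fin N) → ℝ) : ‖momE N α φ‖ₑ ≤ wnorm N K φ := by
  rw [wnorm_eq_lintegral_mul]
  refine (enorm_integral_le_lintegral_enorm _).trans (lintegral_mono fun x => ?_)
  rw [enorm_mul]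
  gcongr
  rw [← ofReal_norm]
  exact ENNReal.ofReal_le_ofReal
    ((abs_mpowE_le α x).trans (pow_le_one_add_rpow (norm_nonneg x) hα))

theorem integrable_mpowE_mul (hK : 0 ≤ K) {φ : EuclideanSpace ℝ (Fin N) → ℝ}
    (hφ : MemL1k N K φ) {α : Fin N → ℕ} (hα : ((∑ i, α i : ℕ) : ℝ) ≤ K) :
    Integrable fun x => mpowE N α x * φ x := by
  refine ((integrable_of_memL1k hφ).norm.add (integrable_rpow_mul_of_memL1k hK hφ).norm).mono'
    ((contDiff_mpowE α).continuous.aestronglyMeasurable.mul hφ.1)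
    (Eventually.of_forall fun x => ?_)
  rw [Pi.add_apply, norm_mul, norm_mul, Real.norm_of_nonneg (by positivity : 0 ≤ ‖x‖ ^ K),
    ← one_add_mul]
  gcongr
  exact (abs_mpowE_le α x).trans (pow_le_one_add_rpow (norm_nonneg x) hα)

end WeightedNorm

section Coefficients

variable {N : ℕ} {G : EuclideanSpace ℝ (Fin N) → ℝ → ℝ}

theorem sum_lt_sum_of_mem_erase {α β : Fin N → ℕ} (h : β ∈ (Finset.Iic α).erase α) :
    ∑ i, β i < ∑ i, α i := by
  rw [Finset.mem_erase, Finset.mem_Iic] at h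
  obtain ⟨-, i, hi⟩ := Pi.lt_def.1 (lt_of_le_of_ne h.2 h.1)
  exact Finset.sum_lt_sum (fun i _ => h.2 i) ⟨i, Finset.mem_univ i, hi⟩

theorem McoefAux_congr (f : EuclideanSpace ℝ (Fin N) → ℝ) (t : ℝ) {n m : ℕ} {α : Fin N → ℕ}
    (hn : ∑ i, α i ≤ n) (hm : ∑ i, α i ≤ m) :
    McoefAux N G f t n α = McoefAux N G f t m α := by
  have h0 : ∀ α : Fin N → ℕ, ∑ i, α i ≤ 0 → (Finset.Iic α).erase α = ∅ := fun α h =>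
    Finset.eq_empty_of_forall_notMem fun β hβ => by
      have := sum_lt_sum_of_mem_erase hβ
      omega
  induction n generalizing m α with
  | zero =>
    cases m with
    | zero => rfl
    | succ m => simp [McoefAux, h0 α hn]
  | succ n ih =>
    cases m with
    | zero => simp [McoefAux, h0 α hm]
    | succ m =>
      simp only [McoefAux]
      congr 1
      refine Finset.sum_congr rfl fun β hβ => ?_
      have := sum_lt_sum_of_mem_erase hβ
      rw [ih (m := m) (by omega) (by omega)]

theorem Mcoef_eq (f : EuclideanSpace ℝ (Fin N) → ℝ) (t : ℝ) (α : Fin N → ℕ) :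
    Mcoef N G f t α = momE N α f - ∑ β ∈ (Finset.Iic α).erase α,
      Mcoef N G f t β * ∫ x, mpowE N α x * gA N G β x t := by
  rw [Mcoef, McoefAux_congr f t le_rfl (Nat.le_succ _), McoefAux]
  congr 1
  refine Finset.sum_congr rfl fun β hβ => ?_
  rw [Mcoef, McoefAux_congr f t (sum_lt_sum_of_mem_erase hβ).le le_rfl]

theorem exists_enorm_McoefAux_le {K : ℝ} (t : ℝ) (n : ℕ) {α : Fin N → ℕ}
    (hα : ((∑ i, α i : ℕ) : ℝ) ≤ K) :
    ∃ C : ℝ≥0∞, C ≠ ⊤ ∧ ∀ f, ‖McoefAux N G f t n α‖ₑ ≤ C * wnorm N K f := by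
  induction n generalizing α with
  | zero => exact ⟨1, by simp, fun f => by simpa [McoefAux] using enorm_momE_le hα f⟩
  | succ n ih =>
    have hβ : ∀ β ∈ (Finset.Iic α).erase α, ((∑ i, β i : ℕ) : ℝ) ≤ K := fun β hβ =>
      (Nat.cast_le.2 (sum_lt_sum_of_mem_erase hβ).le).trans hα
    choose! C hC h using fun β hb => ih (hβ β hb)
    refine ⟨1 + ∑ β ∈ (Finset.Iic α).erase α, C β * ‖∫ x, mpowE N α x * gA N G β x t‖ₑ,
      ENNReal.add_ne_top.2 ⟨by simp, ENNReal.sum_ne_top.2 fun β hb =>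
        ENNReal.mul_ne_top (hC β hb) enorm_ne_top⟩, fun f => ?_⟩
    rw [McoefAux, add_mul, one_mul, Finset.sum_mul]
    refine enorm_sub_le.trans (add_le_add (enorm_momE_le hα f)
      ((enorm_sum_le _ _).trans (Finset.sum_le_sum fun β hb => ?_)))
    rw [enorm_mul, mul_right_comm]
    gcongr
    exact h β hb f

end Coefficients

section Projection

variable {N γ : ℕ} {d L K : ℝ} {G : EuclideanSpace ℝ (Fin N) → ℝ → ℝ}

theorem sum_le_of_mem_multiIdx {m : ℕ} {α : Fin N → ℕ} (hα : α ∈ multiIdx N m) :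
    ∑ i, α i ≤ m :=
  (Finset.mem_filter.1 hα).2

theorem mem_multiIdx_of_sum_le {m : ℕ} {α : Fin N → ℕ} (hα : ∑ i, α i ≤ m) :
    α ∈ multiIdx N m :=
  Finset.mem_filter.2 ⟨Finset.mem_Iic.2 fun i =>
    (Finset.single_le_sum (fun _ _ => Nat.zero_le _) (Finset.mem_univ i)).trans hα, hα⟩

theorem integrable_rpow_mul_gA (hG : CondG N G γ d L) (hK : 0 ≤ K) (hKL : K < L)
    {α : Fin N → ℕ} (hα : ∑ i, α i ≤ γ) : Integrable fun y => ‖y‖ ^ K * gA N G α y 0 := by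
  have h := (hasDecay_gA (n := 0) hG (by simpa using hα)).integrable_norm_rpow_mul hK
    (by simpa using hKL)
  simpa [gA, mul_left_comm] using h.const_mul ((-1 : ℝ) ^ (∑ i, α i) / (mfactE N α : ℝ))

theorem integrable_PKop (hG : CondG N G γ d L) (hK : 0 ≤ K) (hKL : K < L) (hKγ : ⌊K⌋₊ ≤ γ)
    {φ : EuclideanSpace ℝ (Fin N) → ℝ} (hφ : Integrable φ) : Integrable (PKop N G K 0 φ) :=
  hφ.sub (integrable_finsetSum _ fun _ hα =>
    (integrable_gA hG (by linarith) ((sum_le_of_mem_multiIdx hα).trans hKγ)).const_mul _)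

theorem exists_wnorm_PKop_le (hG : CondG N G γ d L) (hK : 0 ≤ K) (hKL : K < L)
    (hKγ : ⌊K⌋₊ ≤ γ) :
    ∃ C : ℝ≥0∞, C ≠ ⊤ ∧ ∀ φ, AEStronglyMeasurable φ →
      wnorm N K (PKop N G K 0 φ) ≤ C * wnorm N K φ := by
  have hγ : ∀ α ∈ multiIdx N ⌊K⌋₊, ∑ i, α i ≤ γ := fun α hα =>
    (sum_le_of_mem_multiIdx hα).trans hKγ
  choose! C hC h using fun (α : Fin N → ℕ) (hα : α ∈ multiIdx N ⌊K⌋₊) =>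
    exists_enorm_McoefAux_le (G := G) 0 (∑ i, α i)
      ((Nat.cast_le.2 (sum_le_of_mem_multiIdx hα)).trans (Nat.floor_le hK))
  refine ⟨1 + ∑ α ∈ multiIdx N ⌊K⌋₊, C α * wnorm N K fun y => gA N G α y 0,
    ENNReal.add_ne_top.2 ⟨by simp, ENNReal.sum_ne_top.2 fun α hα => ENNReal.mul_ne_top (hC α hα)
      (wnorm_lt_top (integrable_gA hG (by linarith) (hγ α hα))
        (integrable_rpow_mul_gA hG hK hKL (hγ α hα))).ne⟩, fun φ hφ => ?_⟩
  refine (wnorm_sub_sum_le (multiIdx N ⌊K⌋₊) hφ (Mcoef N G φ 0) (h := fun α y => gA N G α y 0)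
    fun α hα => (integrable_gA hG (by linarith) (hγ α hα)).1).trans ?_
  rw [add_mul, one_mul, Finset.sum_mul]
  refine add_le_add le_rfl (Finset.sum_le_sum fun α hα => ?_)
  rw [mul_right_comm]
  gcongr
  exact h α hα φ

theorem memL1k_PKop (hG : CondG N G γ d L) (hK : 0 ≤ K) (hKL : K < L) (hKγ : ⌊K⌋₊ ≤ γ)
    {φ : EuclideanSpace ℝ (Fin N) → ℝ} (hφ : MemL1k N K φ) : MemL1k N K (PKop N G K 0 φ) := by
  obtain ⟨C, hC, h⟩ := exists_wnorm_PKop_le hG hK hKL hKγ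
  exact ⟨(integrable_PKop hG hK hKL hKγ (integrable_of_memL1k hφ)).1,
    (h φ hφ.1).trans_lt (ENNReal.mul_lt_top hC.lt_top hφ.2)⟩

theorem integral_mpowE_mul_gA (hG : CondG N G γ d L) {α β : Fin N → ℕ}
    (hα : ((∑ i, α i : ℕ) : ℝ) < L) (hβ : ∑ i, β i ≤ γ) :
    (¬ β ≤ α → ∫ x, mpowE N α x * gA N G β x 0 = 0) ∧
      (β = α → ∫ x, mpowE N α x * gA N G β x 0 = ∫ x, G x 1) := by
  have hg := (hasDecay_kernel hG).mono ((length_idxList β).trans_le hβ)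
  have hα' : N + ((∑ i, α i : ℕ) : ℝ) < N + L := by linarith
  simp only [gA, zero_add, mul_left_comm (mpowE N α _), integral_const_mul, mderivE_eq_pderivList]
  refine ⟨fun h => ?_, fun h => ?_⟩
  · rw [hg.integral_mpowE_mul_pderivList_eq_zero _ hα', mul_zero]
    simpa [count_idxList, Pi.le_def] using h
  · subst h
    rw [hg.integral_mpowE_mul_pderivList_self _ hα' fun i => (count_idxList β i).symm,
      length_idxList]
    have : (mfactE N β : ℝ) ≠ 0 :=
      Nat.cast_ne_zero.2 (Finset.prod_ne_zero_iff.2 fun i _ => Nat.factorial_ne_zero _)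
    field_simp
    rw [pow_right_comm, neg_one_sq, one_pow, one_mul]

theorem integral_mpowE_mul_PKop (hG : CondG N G γ d L) (h1 : ∫ x, G x 1 = 1) (hK : 0 ≤ K)
    (hKL : K < L) (hKγ : ⌊K⌋₊ ≤ γ) {φ : EuclideanSpace ℝ (Fin N) → ℝ} (hφ : MemL1k N K φ)
    {α : Fin N → ℕ} (hα : ∑ i, α i ≤ ⌊K⌋₊) :
    ∫ x, mpowE N α x * PKop N G K 0 φ x = 0 := by
  have hαK : ((∑ i, α i : ℕ) : ℝ) ≤ K := (Nat.cast_le.2 hα).trans (Nat.floor_le hK)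
  have hγ : ∀ β ∈ multiIdx N ⌊K⌋₊, ∑ i, β i ≤ γ := fun β hβ =>
    (sum_le_of_mem_multiIdx hβ).trans hKγ
  have hi : ∀ β ∈ multiIdx N ⌊K⌋₊,
      Integrable fun x => Mcoef N G φ 0 β * (mpowE N α x * gA N G β x 0) := fun β hβ =>
    (integrable_mpowE_mul hK ⟨(integrable_gA hG (by linarith) (hγ β hβ)).1,
      wnorm_lt_top (integrable_gA hG (by linarith) (hγ β hβ))
        (integrable_rpow_mul_gA hG hK hKL (hγ β hβ))⟩ hαK).const_mul _
  simp only [PKop, mul_sub, Finset.mul_sum, mul_left_comm (mpowE N α _)]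
  rw [integral_sub (integrable_mpowE_mul hK hφ hαK) (integrable_finsetSum _ hi),
    integral_finsetSum _ hi]
  simp only [integral_const_mul]
  have hsub : Finset.Iic α ⊆ multiIdx N ⌊K⌋₊ := fun β hβ =>
    mem_multiIdx_of_sum_le ((Finset.sum_le_sum fun i _ => Finset.mem_Iic.1 hβ i).trans hα)
  rw [← Finset.sum_subset hsub fun β hβ hβα => by
    rw [(integral_mpowE_mul_gA hG (hαK.trans_lt hKL) (hγ β hβ)).1
      (fun h => hβα (Finset.mem_Iic.2 h)), mul_zero],
    ← Finset.add_sum_erase _ _ (Finset.mem_Iic.2 le_rfl : α ∈ Finset.Iic α),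
    (integral_mpowE_mul_gA hG (hαK.trans_lt hKL) (hα.trans hKγ)).2 rfl, h1, mul_one, Mcoef_eq,
    sub_add_cancel, momE, sub_self]

theorem multilinear_diag_eq_sum {k : ℕ} (T : EuclideanSpace ℝ (Fin N) [×k]→L[ℝ] ℝ)
    (y : EuclideanSpace ℝ (Fin N)) :
    T (fun _ => y) = ∑ r : Fin k → Fin N,
      mpowE N (fun i => Fintype.card {l // r l = i}) y *
        T fun l => EuclideanSpace.single (r l) 1 := by
  have hy : y = ∑ i, y i • EuclideanSpace.single i (1 : ℝ) := by
    simpa using ((EuclideanSpace.basisFun (Fin N) ℝ).sum_repr y).symm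
  have h : T (fun _ => y) = T fun _ : Fin k => ∑ i, y i • EuclideanSpace.single i (1 : ℝ) := by
    rw [← hy]
  rw [h, ContinuousMultilinearMap.map_sum]
  refine Finset.sum_congr rfl fun r _ => ?_
  rw [ContinuousMultilinearMap.map_smul_univ, smul_eq_mul, mpowE]
  congr 1
  rw [← Finset.prod_fiberwise (Finset.univ : Finset (Fin k)) r]
  refine Finset.prod_congr rfl fun i _ => ?_
  rw [Finset.prod_congr rfl fun l hl => by rw [(Finset.mem_filter.1 hl).2], Finset.prod_const,
    Fintype.card_subtype]

theorem integral_PKop_mul_multilinear (hG : CondG N G γ d L) (h1 : ∫ x, G x 1 = 1) (hK : 0 ≤ K)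
    (hKL : K < L) (hKγ : ⌊K⌋₊ ≤ γ) {φ : EuclideanSpace ℝ (Fin N) → ℝ} (hφ : MemL1k N K φ)
    {k : ℕ} (hk : k ≤ ⌊K⌋₊) (T : EuclideanSpace ℝ (Fin N) [×k]→L[ℝ] ℝ) :
    ∫ y, PKop N G K 0 φ y * T (fun _ => y) = 0 := by
  have hr : ∀ r : Fin k → Fin N, ∑ i, Fintype.card {l // r l = i} = k := fun r => by
    rw [← Fintype.card_sigma, Fintype.card_congr (Equiv.sigmaFiberEquiv r), Fintype.card_fin]
  have hkK : (k : ℝ) ≤ K := (Nat.cast_le.2 hk).trans (Nat.floor_le hK)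
  simp only [multilinear_diag_eq_sum T, Finset.mul_sum, mul_left_comm (PKop N G K 0 φ _),
    ← mul_assoc]
  rw [integral_finsetSum]
  · refine Finset.sum_eq_zero fun r _ => ?_
    rw [integral_mul_const,
      integral_mpowE_mul_PKop hG h1 hK hKL hKγ hφ ((hr r).trans_le hk), zero_mul]
  · intro r _
    exact (integrable_mpowE_mul hK (memL1k_PKop hG hK hKL hKγ hφ)
      (by rw [hr r]; exact hkK)).mul_const _

end Projection

theorem aestronglyMeasurable_iteratedFDeriv_conv {E : Type*} [NormedAddCommGroup E]
    [NormedSpace ℝ E] [MeasureSpace E] [BorelSpace E] [FiniteDimensional ℝ E]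
    {n : ℕ} {a : ℝ} {f : E → ℝ} (hf : HasDecay n a f) (ha : 0 ≤ a) {u : E → ℝ}
    (hu : Integrable u) {j : ℕ} (hj : j ≤ n) :
    AEStronglyMeasurable (iteratedFDeriv ℝ j (conv f u)) := by
  obtain ⟨C, -, hC⟩ := hf.exists_norm_le ha hj
  rw [hf.iteratedFDeriv_conv ha hu hj]
  exact (continuous_conv (hf.contDiff.continuous_iteratedFDeriv (by exact_mod_cast hj)) hC
    hu).aestronglyMeasurable

end SelfSimilar

/-- Theorem 1.1 (decay estimate): for the linearized remainder
`v(x,t) = e^{tℒ}φ(x) - ∑_{|α|≤K} M_α(φ,0) g_α(x,t)`, one has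
`t^{(N/d)(1-1/q)+j/d}‖∇ʲv(t)‖_q + t^{j/d}(1+t)^{-ℓ/d}|||∇ʲv(t)|||_ℓ
  ≤ C (1+t)^{-K/d} |||φ|||_K`. -/
theorem stmt0 (N γ : ℕ) (hN : 1 ≤ N) (d L : ℝ) (hd : 0 < d) (hL : 0 < L)
    (G : EuclideanSpace ℝ (Fin N) → ℝ → ℝ) (hG : CondG N G γ d L)
    (K : ℝ) (hK0 : 0 ≤ K) (hKL : K < L) (hKγ : ⌈K⌉₊ + 1 ≤ γ)
    (j : ℕ) (hj : j ≤ γ) (q : ℝ≥0∞) (hq : 1 ≤ q) (ℓ : ℝ) (hℓ : ℓ ∈ Set.Icc 0 K) :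
    ∃ C : ℝ, 0 < C ∧ ∀ φ : EuclideanSpace ℝ (Fin N) → ℝ, MemL1k N K φ →
      ∀ t : ℝ, 0 < t →
        ENNReal.ofReal (t ^ (((N : ℝ) / d) * (1 - q.toReal⁻¹) + (j : ℝ) / d)) *
            eLpNorm (fun x => iteratedFDeriv ℝ j
              (fun y => sgOp N G t φ y -
                ∑ α ∈ multiIdx N ⌊K⌋₊, Mcoef N G φ 0 α * gA N G α y t) x) q volume +
          ENNReal.ofReal (t ^ ((j : ℝ) / d) * (1 + t) ^ (-ℓ / d)) *
            wnorm N ℓ (fun x => iteratedFDeriv ℝ j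
              (fun y => sgOp N G t φ y -
                ∑ α ∈ multiIdx N ⌊K⌋₊, Mcoef N G φ 0 α * gA N G α y t) x) ≤
        ENNReal.ofReal (C * (1 + t) ^ (-K / d)) * wnorm N K φ := by
  have hKγ' : ⌊K⌋₊ + 1 ≤ γ := (Nat.add_le_add_right (Nat.floor_le_ceil K) 1).trans hKγ
  have hfl : ⌊K⌋₊ ≤ γ := (Nat.le_succ _).trans hKγ'
  have hg := SelfSimilar.hasDecay_kernel hG
  have hsg : ∀ t s : ℝ, 0 < t → 0 < s → _ := fun t s ht hs => SelfSimilar.dil_kernel_add hG ht hs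
  have hv : ∀ φ, MemL1k N K φ → ∀ t : ℝ, 0 < t →
      (fun y => sgOp N G t φ y - ∑ α ∈ multiIdx N ⌊K⌋₊, Mcoef N G φ 0 α * gA N G α y t) =
        SelfSimilar.conv (SelfSimilar.dil (fun y => G y 1) (t ^ d⁻¹)) (PKop N G K 0 φ) :=
    fun φ hφ t ht =>
      SelfSimilar.sgOp_sub_sum_eq_conv hG hL hfl (SelfSimilar.integrable_of_memL1k hφ) _ ht
  rcases (hg.mono (m := 1) (by omega)).integral_eq_one_or_eq_zero hd (by simpa using hL) hsg with
    h1 | h0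
  · obtain ⟨C, hC, h⟩ := hg.exists_decay_of_moments hKγ' hd hℓ.1
      (by simpa using hℓ.2.trans_lt hKL) hℓ.2 (Nat.floor_le hK0) (Nat.lt_floor_add_one K).le hsg hj hq
    obtain ⟨C', hC', h'⟩ := SelfSimilar.exists_wnorm_PKop_le hG hK0 hKL hfl
    refine ⟨(C * C').toReal + 1, by positivity, fun φ hφ t ht => ?_⟩
    have hψ := SelfSimilar.memL1k_PKop hG hK0 hKL hfl hφ
    have hψi := SelfSimilar.integrable_of_memL1k hψ
    have hmain := h t ht (PKop N G K 0 φ) hψi (SelfSimilar.integrable_rpow_mul_of_memL1k hK0 hψ)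
      fun k hk T => SelfSimilar.integral_PKop_mul_multilinear hG h1 hK0 hKL hfl hφ hk T
    rw [hv φ hφ t ht, SelfSimilar.wnorm_eq_add ℓ
      (SelfSimilar.aestronglyMeasurable_iteratedFDeriv_conv (hg.dilation (by positivity)
        (by positivity)) (by positivity) hψi hj)]
    rw [← SelfSimilar.wnorm_eq_add K hψ.1, finrank_euclideanSpace_fin] at hmain
    have he : (N : ℝ) / d * (1 - q.toReal⁻¹) + j / d = (N * (1 - q.toReal⁻¹) + j) / d := by ring
    rw [he]
    refine hmain.trans ?_
    calc _ ≤ C * ENNReal.ofReal ((1 + t) ^ (-K / d)) * (C' * wnorm N K φ) := by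
          gcongr
          exact h' φ hφ.1
      _ = C * C' * ENNReal.ofReal ((1 + t) ^ (-K / d)) * wnorm N K φ := by ring
      _ ≤ _ := by
          rw [ENNReal.ofReal_mul (by positivity)]
          gcongr
          rw [← ENNReal.ofReal_toReal (ENNReal.mul_ne_top hC hC')]
          exact ENNReal.ofReal_le_ofReal (by rw [ENNReal.toReal_ofReal (by positivity)]; simp)
  · refine ⟨1, one_pos, fun φ hφ t ht => ?_⟩
    have h2 : (fun y => sgOp N G t φ y -
        ∑ α ∈ multiIdx N ⌊K⌋₊, Mcoef N G φ 0 α * gA N G α y t) = 0 := by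
      rw [hv φ hφ t ht, h0]
      ext x
      simp [SelfSimilar.conv, SelfSimilar.dil]
    rw [h2]
    simp [wnorm]
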